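/- arXiv:1602.00347 — 2 statements merged into one kernel-verified Lean document; each statement's English description precedes it below -/
import Mathlib

section
/- There exists a positive constant C such that for every finite simple triangle-free graph G with maximum degree Δ ≥ 2, the correspondence chromatic number of G satisfies χ_c(G) ≤ C·Δ/ln Δ. -/
open Classical Finset Real

/-- A cover `(L, H)` of a graph `G`. Colors form a type `W`; `toFun` sends each color to the
vertex it belongs to, so that the list of `v` is `L v = toFun ⁻¹' {v}` (the lists are then
automatically pairwise disjoint). `graph` is the cover graph `H`. -/
structure Cover {V : Type*} (G : SimpleGraph V) (W : Type*) where
  toFun : W → V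
  graph : SimpleGraph W
  adj_map : ∀ ⦃x y : W⦄, graph.Adj x y → G.Adj (toFun x) (toFun y)
  matching : ∀ ⦃x y y' : W⦄, graph.Adj x y → graph.Adj x y' → toFun y = toFun y' → y = y'

namespace Cover

variable {V W : Type*} {G : SimpleGraph V}

/-- `I` is an `(L,H)`-coloring of `G`: an independent set of `H` meeting every list. -/
def IsColoring (C : Cover G W) (I : Set W) : Prop :=
  (∀ ⦃x⦄, x ∈ I → ∀ ⦃y⦄, y ∈ I → ¬ C.graph.Adj x y) ∧ ∀ v : V, ∃ x ∈ I, C.toFun x = v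

/-- `G` is `(L,H)`-colorable. -/
def Colorable (C : Cover G W) : Prop := ∃ I : Set W, C.IsColoring I

end Cover

/-- `G` is `k`-correspondence-colorable. -/
def CorrColorable {V : Type} [Fintype V] (G : SimpleGraph V) (k : ℕ) : Prop :=
  ∀ (W : Type) [Fintype W] (C : Cover G W),
    (∀ v : V, k ≤ Fintype.card {x : W // C.toFun x = v}) → C.Colorable

/-- The correspondence chromatic number `χ_c(G)`. -/
noncomputable def corrChromaticNumber {V : Type} [Fintype V] (G : SimpleGraph V) : ℕ :=
  sInf {k : ℕ | CorrColorable G k}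

lemma mul_card_le_sum_of_fiberwise {α β : Type*} [DecidableEq β] (s : Finset α)
    (r : α → β) (φ : α → ℝ) (c : ℝ)
    (h : ∀ a ∈ s, c * #{b ∈ s | r b = r a} ≤ ∑ b ∈ s with r b = r a, φ b) :
    c * #s ≤ ∑ b ∈ s, φ b := by
  have hr : ∀ a ∈ s, r a ∈ s.image r := fun a ha => mem_image_of_mem r ha
  rw [← sum_fiberwise_of_maps_to hr, card_eq_sum_card_fiberwise hr, Nat.cast_sum, mul_sum]
  refine sum_le_sum fun b hb => ?_
  obtain ⟨a, ha, rfl⟩ := mem_image.1 hb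
  exact h a ha

lemma exp_neg_two_mul_le_one_sub {p : ℝ} (h0 : 0 ≤ p) (h1 : p ≤ 1 / 2) :
    exp (-(2 * p)) ≤ 1 - p := by
  rw [exp_neg, inv_le_iff_one_le_mul₀ (exp_pos _)]
  nlinarith [add_one_le_exp (2 * p)]

lemma card_mul_exp_neg_le_sum_exp_neg {α : Type*} (X : Finset α) (s : α → ℝ) (m : ℝ)
    (h : ∑ x ∈ X, s x ≤ #X * m) : #X * exp (-m) ≤ ∑ x ∈ X, exp (-s x) := by
  have key : ∀ x, exp (-m) * (1 + m - s x) ≤ exp (-s x) := fun x => by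
    have : exp (-s x) = exp (-m) * exp (m - s x) := by rw [← exp_add]; ring_nf
    rw [this]
    exact mul_le_mul_of_nonneg_left (by linarith [add_one_le_exp (m - s x)]) (exp_pos _).le
  calc #X * exp (-m) ≤ ∑ x ∈ X, exp (-m) * (1 + m - s x) := by
        rw [← mul_sum, sum_sub_distrib, sum_const, nsmul_eq_mul]
        nlinarith [exp_pos (-m)]
    _ ≤ _ := sum_le_sum fun x _ => key x

/-- If each coordinate of `f` is chosen independently and uniformly from `F u`, then the expected
number of `x ∈ X` unblocked by the coordinates in `A` is at least `#X * exp (-2 * d / #X)`. -/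
lemma prod_card_mul_exp_le_sum_card_unblocked {V W : Type*} [Fintype V] (F : V → Finset W)
    (X : Finset W) (A : Finset V) (R : W → W → Prop) (d : ℕ) (hA : #A ≤ d)
    (hF : ∀ u ∈ A, 2 ≤ #(F u))
    (hR₁ : ∀ x ∈ X, ∀ u ∈ A, #{y ∈ F u | R x y} ≤ 1)
    (hR₂ : ∀ u ∈ A, ∀ y ∈ F u, #{x ∈ X | R x y} ≤ 1) :
    #X * exp (-(2 * d / #X)) * #(Fintype.piFinset F) ≤
      ∑ f ∈ Fintype.piFinset F, (#{x ∈ X | ∀ u ∈ A, ¬ R x (f u)} : ℝ) := by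
  rcases X.eq_empty_or_nonempty with rfl | hX
  · simp
  have hX0 : (0 : ℝ) < #X := by exact_mod_cast hX.card_pos
  set p : V → W → ℝ := fun u x => #{y ∈ F u | R x y} / #(F u) with hp
  have hswap : ∑ f ∈ Fintype.piFinset F, (#{x ∈ X | ∀ u ∈ A, ¬ R x (f u)} : ℝ) =
      ∑ x ∈ X, (#{f ∈ Fintype.piFinset F | ∀ u ∈ A, ¬ R x (f u)} : ℝ) := by
    exact_mod_cast sum_card_bipartiteAbove_eq_sum_card_bipartiteBelow
      (fun (f : V → W) x => ∀ u ∈ A, ¬ R x (f u))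
  have hsum : ∑ x ∈ X, ∑ u ∈ A, 2 * p u x ≤ #X * (2 * d / #X) := by
    rw [sum_comm]
    have : ∀ u ∈ A, ∑ x ∈ X, 2 * p u x ≤ 2 := fun u hu => by
      have hpos : (0 : ℝ) < #(F u) := by
        have := hF u hu
        exact_mod_cast (by omega : 0 < #(F u))
      rw [← mul_sum, hp, ← sum_div]
      have : ∑ x ∈ X, #{y ∈ F u | R x y} ≤ #(F u) := by
        refine (sum_card_bipartiteAbove_eq_sum_card_bipartiteBelow R).trans_le ?_
        rw [card_eq_sum_ones]
        exact sum_le_sum fun y hy => hR₂ u hu y hy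
      have : (∑ x ∈ X, (#{y ∈ F u | R x y} : ℝ)) / #(F u) ≤ 1 := by
        rw [div_le_one hpos]
        exact_mod_cast this
      linarith
    calc _ ≤ ∑ u ∈ A, (2 : ℝ) := sum_le_sum this
      _ = #A * 2 := by simp
      _ ≤ d * 2 := by gcongr
      _ = _ := by field_simp
  have hx : ∀ x ∈ X, #(Fintype.piFinset F) * exp (-∑ u ∈ A, 2 * p u x) ≤
      #{f ∈ Fintype.piFinset F | ∀ u ∈ A, ¬ R x (f u)} := fun x hx => by
    have : {f ∈ Fintype.piFinset F | ∀ u ∈ A, ¬ R x (f u)} =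
        Fintype.piFinset fun u => {y ∈ F u | u ∈ A → ¬ R x y} := by
      ext f
      simp only [mem_filter, Fintype.mem_piFinset]
      exact forall_and.symm
    rw [this, Fintype.card_piFinset, Fintype.card_piFinset, ← sum_neg_distrib, exp_sum,
      ← Fintype.prod_ite_mem A, Nat.cast_prod, Nat.cast_prod, ← prod_mul_distrib]
    refine prod_le_prod (fun u _ => by positivity) fun u _ => ?_
    by_cases hu : u ∈ A
    · have h2 : (2 : ℝ) ≤ #(F u) := by exact_mod_cast hF u hu
      have h1 : (#{y ∈ F u | R x y} : ℝ) ≤ 1 := by exact_mod_cast hR₁ x hx u hu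
      have hle : p u x ≤ 1 / 2 := by
        rw [hp, div_le_div_iff₀ (by linarith) two_pos]
        linarith
      have hsplit : (#{y ∈ F u | R x y} : ℝ) + #{y ∈ F u | ¬ R x y} = #(F u) := by
        exact_mod_cast card_filter_add_card_filter_not (s := F u) (R x)
      have hmul : (#(F u) : ℝ) * p u x = #{y ∈ F u | R x y} := by
        rw [hp]
        field_simp
      simp only [hu, if_true, forall_const]
      calc _ ≤ (#(F u) : ℝ) * (1 - p u x) := by
            gcongr
            exact exp_neg_two_mul_le_one_sub (by positivity) hle
        _ = _ := by linarith
    · simp [hu]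
  rw [hswap]
  calc _ = #(Fintype.piFinset F) * (#X * exp (-(2 * d / #X))) := by ring
    _ ≤ #(Fintype.piFinset F) * ∑ x ∈ X, exp (-∑ u ∈ A, 2 * p u x) := by
        gcongr
        exact card_mul_exp_neg_le_sum_exp_neg X _ _ hsum
    _ ≤ _ := by
        rw [mul_sum]
        exact sum_le_sum hx

namespace Cover

variable {V W : Type*} [Fintype W] {G : SimpleGraph V}

/-- The proper colorings of `S`, extended by the junk value `w₀` outside `S`. -/
noncomputable def partialColorings [Fintype V] (C : Cover G W) (w₀ : W) (S : Finset V) :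
    Finset (V → W) :=
  {f | (∀ v ∉ S, f v = w₀) ∧ ∀ v ∈ S, C.toFun (f v) = v ∧ ∀ u ∈ S, ¬ C.graph.Adj (f v) (f u)}

/-- The colors of `v` which have no neighbor among the colors that `f` assigns to `S`. -/
noncomputable def available (C : Cover G W) (S : Finset V) (f : V → W) (v : V) : Finset W :=
  {x | C.toFun x = v ∧ ∀ u ∈ S, ¬ C.graph.Adj x (f u)}

variable (C : Cover G W) {S : Finset V} {f g : V → W} {u v : V} {x : W}

lemma mem_available :
    x ∈ C.available S f v ↔ C.toFun x = v ∧ ∀ u ∈ S, ¬ C.graph.Adj x (f u) := by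
  simp [available]

lemma card_filter_adj_le_one (v : V) (y : W) :
    #{x | C.toFun x = v ∧ C.graph.Adj x y} ≤ 1 := by
  refine card_le_one.2 fun a ha b hb => ?_
  simp only [mem_filter, mem_univ, true_and] at ha hb
  exact C.matching ha.2.symm hb.2.symm (ha.1.trans hb.1.symm)

variable [Fintype V] (w₀ : W)

lemma mem_partialColorings : f ∈ C.partialColorings w₀ S ↔ (∀ v ∉ S, f v = w₀) ∧
    ∀ v ∈ S, C.toFun (f v) = v ∧ ∀ u ∈ S, ¬ C.graph.Adj (f v) (f u) := by
  simp [partialColorings]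

lemma update_mem_partialColorings (hv : v ∉ S) (hf : f ∈ C.partialColorings w₀ S)
    (hx : x ∈ C.available S f v) :
    Function.update f v x ∈ C.partialColorings w₀ (insert v S) := by
  rw [mem_partialColorings] at hf ⊢
  rw [mem_available] at hx
  have hne : ∀ u ∈ S, u ≠ v := fun u hu h => hv (h ▸ hu)
  refine ⟨fun u hu => ?_, fun u hu => ?_⟩
  · rw [mem_insert, not_or] at hu
    rw [Function.update_of_ne hu.1, hf.1 u hu.2]
  · rcases mem_insert.1 hu with rfl | huS
    · refine ⟨by simpa using hx.1, fun w hw => ?_⟩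
      rcases mem_insert.1 hw with rfl | hw
      · simp
      · rw [Function.update_self, Function.update_of_ne (hne w hw)]
        exact hx.2 w hw
    · rw [Function.update_of_ne (hne u huS)]
      refine ⟨(hf.2 u huS).1, fun w hw => ?_⟩
      rcases mem_insert.1 hw with rfl | hw
      · rw [Function.update_self, C.graph.adj_comm]
        exact hx.2 u huS
      · rw [Function.update_of_ne (hne w hw)]
        exact (hf.2 u huS).2 w hw

lemma sum_card_available_le (hv : v ∉ S) :
    ∑ f ∈ C.partialColorings w₀ S, #(C.available S f v) ≤
      #(C.partialColorings w₀ (insert v S)) := by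
  rw [← card_sigma]
  refine card_le_card_of_injOn (fun p => Function.update p.1 v p.2) (fun p hp => ?_) ?_
  · rw [mem_coe, mem_sigma] at hp
    exact C.update_mem_partialColorings w₀ hv hp.1 hp.2
  · rintro ⟨f, x⟩ hp ⟨g, y⟩ hq h
    simp only [coe_sigma, Set.mem_sigma_iff, mem_coe, mem_partialColorings] at hp hq
    have hxy : x = y := by simpa using congrFun h v
    have hfg : f = g := by
      ext u
      by_cases hu : u = v
      · rw [hu, hp.1.1 v hv, hq.1.1 v hv]
      · simpa [hu] using congrFun h u
    rw [hxy, hfg]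

lemma apply_mem_available (hf : f ∈ C.partialColorings w₀ S) (hu : u ∈ S) :
    f u ∈ C.available S f u := by
  rw [mem_partialColorings] at hf
  exact C.mem_available.2 (hf.2 u hu)

lemma available_congr {A : Finset V} (hA : ∀ u ∈ A, ∀ w ∈ A, ¬ G.Adj u w)
    (hf : f ∈ C.partialColorings w₀ S) (hg : ∀ w ∈ S, C.toFun (g w) = w)
    (h : ∀ w ∉ A, f w = g w) (hu : u ∈ A) : C.available S f u = C.available S g u := by
  rw [mem_partialColorings] at hf
  ext y
  rw [mem_available, mem_available]
  refine and_congr_right fun hy => forall₂_congr fun w hw => ?_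
  by_cases hwA : w ∈ A
  · have hf' : ¬ C.graph.Adj y (f w) := fun hadj =>
      hA u hu w hwA (by simpa [hy, (hf.2 w hw).1] using C.adj_map hadj)
    have hg' : ¬ C.graph.Adj y (g w) := fun hadj =>
      hA u hu w hwA (by simpa [hy, hg w hw] using C.adj_map hadj)
    simp [hf', hg']
  · rw [h w hwA]

lemma card_filter_card_available_le (hu : u ∈ S) :
    #{f ∈ C.partialColorings w₀ S | #(C.available S f u) ≤ 1} ≤
      #(C.partialColorings w₀ (S.erase u)) := by
  refine card_le_card_of_injOn (fun f => Function.update f u w₀) (fun f hf => ?_) ?_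
  · rw [mem_coe, mem_filter, mem_partialColorings] at hf
    obtain ⟨⟨h1, h2⟩, -⟩ := hf
    rw [mem_coe, mem_partialColorings]
    refine ⟨fun v hv => ?_, fun v hv => ?_⟩
    · by_cases h : v = u
      · simp [h]
      · simpa [h] using h1 v fun hvS => hv (mem_erase.2 ⟨h, hvS⟩)
    · rw [mem_erase] at hv
      refine ⟨by simpa [hv.1] using (h2 v hv.2).1, fun w hw => ?_⟩
      rw [mem_erase] at hw
      simpa [hv.1, hw.1] using (h2 v hv.2).2 w hw.2
  · intro f hf g hg h
    rw [mem_coe, mem_filter] at hf hg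
    have heq : ∀ w, w ≠ u → f w = g w := fun w hw => by simpa [hw] using congrFun h w
    have hav : C.available S f u = C.available S g u :=
      C.available_congr w₀ (A := {u}) (by simp) hf.1
        (fun w hw => (((C.mem_partialColorings w₀).1 hg.1).2 w hw).1) (by simpa using heq)
        (mem_singleton_self u)
    ext w
    by_cases hw : w = u
    · rw [hw]
      exact card_le_one.1 hf.2 _ (C.apply_mem_available w₀ hf.1 hu) _
        (hav ▸ C.apply_mem_available w₀ hg.1 hu)
    · exact heq w hw

/-- Partial colorings of `S` that agree outside an independent set `A ⊆ S` form a product. -/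
lemma filter_partialColorings_eq_piFinset {A : Finset V} (hAS : A ⊆ S)
    (hA : ∀ u ∈ A, ∀ w ∈ A, ¬ G.Adj u w) (hf : f ∈ C.partialColorings w₀ S) :
    {g ∈ C.partialColorings w₀ S | ∀ w ∉ A, g w = f w} =
      Fintype.piFinset fun u => if u ∈ A then C.available S f u else {f u} := by
  have hf' := (C.mem_partialColorings w₀).1 hf
  ext g
  rw [mem_filter, Fintype.mem_piFinset]
  constructor
  · rintro ⟨hg, h⟩ u
    have hg' := (C.mem_partialColorings w₀).1 hg
    by_cases hu : u ∈ A
    · rw [if_pos hu, ← C.available_congr w₀ hA hg (fun w hw => (hf'.2 w hw).1) h hu]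
      exact C.apply_mem_available w₀ hg (hAS hu)
    · simpa [hu] using h u hu
  · intro h
    have hin : ∀ u ∈ A, C.toFun (g u) = u ∧ ∀ w ∈ S, ¬ C.graph.Adj (g u) (f w) := fun u hu => by
      simpa [hu, mem_available] using h u
    have hout : ∀ u ∉ A, g u = f u := fun u hu => by simpa [hu] using h u
    have hlist : ∀ u ∈ S, C.toFun (g u) = u := fun u hu => by
      by_cases huA : u ∈ A
      · exact (hin u huA).1
      · rw [hout u huA]
        exact (hf'.2 u hu).1
    refine ⟨(C.mem_partialColorings w₀).2 ⟨fun u hu => ?_, fun u hu => ⟨hlist u hu, ?_⟩⟩, hout⟩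
    · rw [hout u fun huA => hu (hAS huA), hf'.1 u hu]
    · intro w hw
      by_cases huA : u ∈ A <;> by_cases hwA : w ∈ A
      · intro hadj
        exact hA u huA w hwA (by simpa [hlist u hu, hlist w hw] using C.adj_map hadj)
      · rw [hout w hwA]
        exact (hin u huA).2 w hw
      · rw [hout u huA, C.graph.adj_comm]
        exact (hin w hwA).2 u hu
      · rw [hout u huA, hout w hwA]
        exact (hf'.2 u hu).2 w hw

lemma card_unblocked_le {A : Finset V} (P : V → Prop) [DecidablePred P]
    (hA : ∀ u, u ∈ A ↔ G.Adj v u ∧ u ∈ S) (hf : f ∈ C.partialColorings w₀ S) :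
    #{x ∈ ({x | C.toFun x = v} : Finset W) | ∀ u ∈ A.filter P, ¬ C.graph.Adj x (f u)} ≤
      #(C.available S f v) + #{u ∈ A | ¬ P u} := by
  have hf' := (C.mem_partialColorings w₀).1 hf
  have hsub : {x ∈ ({x | C.toFun x = v} : Finset W) | ∀ u ∈ A.filter P, ¬ C.graph.Adj x (f u)} ⊆
      C.available S f v ∪
        {u ∈ A | ¬ P u}.biUnion fun u => {x | C.toFun x = v ∧ C.graph.Adj x (f u)} := by
    intro x hx
    simp only [mem_filter, mem_univ, true_and, and_imp] at hx
    rw [mem_union, mem_available, mem_biUnion]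
    by_contra! hcon
    obtain ⟨u, huS, hadj⟩ := hcon.1 hx.1
    have huA : u ∈ A :=
      (hA u).2 ⟨by simpa [hx.1, (hf'.2 u huS).1] using C.adj_map hadj, huS⟩
    by_cases hP : P u
    · exact hx.2 u huA hP hadj
    · exact hcon.2 u (by simp [huA, hP]) (by simp [hx.1, hadj])
  refine (card_le_card hsub).trans ((card_union_le _ _).trans ?_)
  gcongr
  simpa using card_biUnion_le_card_mul _ _ 1 fun u _ => C.card_filter_adj_le_one v (f u)

lemma mul_card_partialColorings_le_sum_unblocked {A : Finset V} (d : ℕ) (hAS : A ⊆ S)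
    (hA : ∀ u ∈ A, ∀ w ∈ A, ¬ G.Adj u w) (hd : #A ≤ d) (X : Finset W)
    (hX : X = ({x | C.toFun x = v} : Finset W)) :
    #X * exp (-(2 * d / #X)) * #(C.partialColorings w₀ S) ≤
      ∑ f ∈ C.partialColorings w₀ S,
        (#{x ∈ X | ∀ u ∈ {u ∈ A | 2 ≤ #(C.available S f u)}, ¬ C.graph.Adj x (f u)} : ℝ) := by
  refine mul_card_le_sum_of_fiberwise _ (fun f (u : {u // u ∉ A}) => f u) _ _ fun f hf => ?_
  have hfib : {g ∈ C.partialColorings w₀ S |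
      (fun u : {u // u ∉ A} => g u) = fun u : {u // u ∉ A} => f u} =
      Fintype.piFinset fun u => if u ∈ A then C.available S f u else {f u} := by
    rw [← C.filter_partialColorings_eq_piFinset w₀ hAS hA hf]
    simp only [funext_iff, Subtype.forall]
  have hcongr : ∀ g ∈ Fintype.piFinset fun u => if u ∈ A then C.available S f u else {f u},
      {u ∈ A | 2 ≤ #(C.available S g u)} = {u ∈ A | 2 ≤ #(C.available S f u)} := fun g hg => by
    rw [← C.filter_partialColorings_eq_piFinset w₀ hAS hA hf, mem_filter] at hg
    refine filter_congr fun u hu => ?_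
    rw [C.available_congr w₀ hA hg.1
      (fun w hw => (((C.mem_partialColorings w₀).1 hf).2 w hw).1) hg.2 hu]
  rw [hfib, sum_congr rfl fun g hg => by rw [hcongr g hg]]
  refine prod_card_mul_exp_le_sum_card_unblocked _ X _ C.graph.Adj d
    ((card_filter_le _ _).trans hd) (fun u hu => ?_) (fun x _ u hu => ?_) (fun u _ y _ => ?_)
  · rw [mem_filter] at hu
    simpa [hu.1] using hu.2
  · rw [mem_filter] at hu
    refine (card_le_card fun y hy => ?_).trans (C.card_filter_adj_le_one u x)
    simp only [hu.1, if_true, mem_filter, mem_available] at hy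
    simpa [hy.1.1] using hy.2.symm
  · rw [hX, filter_filter]
    exact C.card_filter_adj_le_one v y

lemma sqrt_mul_card_partialColorings_le (hG : G.CliqueFree 3) {d : ℕ} (hd : 0 < d)
    (hdeg : ∀ v, #{u | G.Adj v u} ≤ d)
    (hq : ∀ v, 2 * √d ≤ #{x | C.toFun x = v} * exp (-(2 * d / #{x | C.toFun x = v})))
    (S : Finset V) : ∀ v ∉ S,
      √d * #(C.partialColorings w₀ S) ≤ #(C.partialColorings w₀ (insert v S)) := by
  induction S using Finset.strongInduction with
  | H S ih =>
  intro v hv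
  have hd0 : (0 : ℝ) < d := by exact_mod_cast hd
  have hsq : √d * √d = (d : ℝ) := mul_self_sqrt hd0.le
  have hsqrt : 0 < √(d : ℝ) := sqrt_pos.2 hd0
  set Z := C.partialColorings w₀ S with hZ
  set A : Finset V := {u | G.Adj v u ∧ u ∈ S} with hAdef
  have hA : ∀ u, u ∈ A ↔ G.Adj v u ∧ u ∈ S := by simp [hAdef]
  have hAS : A ⊆ S := fun u hu => ((hA u).1 hu).2
  have hAd : #A ≤ d := (card_le_card fun u hu => by simpa using ((hA u).1 hu).1).trans (hdeg v)
  have hAind : ∀ u ∈ A, ∀ w ∈ A, ¬ G.Adj u w := fun u hu w hw huw =>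
    hG {v, u, w} (SimpleGraph.is3Clique_triple_iff.2 ⟨((hA u).1 hu).1, ((hA w).1 hw).1, huw⟩)
  have hbad : √d * ∑ f ∈ Z, (#{u ∈ A | ¬ 2 ≤ #(C.available S f u)} : ℝ) ≤ d * #Z := by
    have hswap : ∑ f ∈ Z, (#{u ∈ A | ¬ 2 ≤ #(C.available S f u)} : ℝ) =
        ∑ u ∈ A, (#{f ∈ Z | ¬ 2 ≤ #(C.available S f u)} : ℝ) := by
      exact_mod_cast sum_card_bipartiteAbove_eq_sum_card_bipartiteBelow
        (fun f u => ¬ 2 ≤ #(C.available S f u))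
    rw [hswap, mul_sum]
    calc _ ≤ ∑ u ∈ A, (#Z : ℝ) := sum_le_sum fun u hu => ?_
      _ = #A * #Z := by simp
      _ ≤ d * #Z := by gcongr
    have hle : (#{f ∈ Z | ¬ 2 ≤ #(C.available S f u)} : ℝ) ≤
        #(C.partialColorings w₀ (S.erase u)) := by
      have := C.card_filter_card_available_le w₀ (hAS hu)
      simp only [not_le, Nat.lt_succ_iff]
      exact_mod_cast this
    have hih := ih (S.erase u) (erase_ssubset (hAS hu)) u (notMem_erase u S)
    rw [insert_erase (hAS hu)] at hih
    exact (mul_le_mul_of_nonneg_left hle hsqrt.le).trans hih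
  have hgood := C.mul_card_partialColorings_le_sum_unblocked w₀ d hAS hAind hAd
    ({x | C.toFun x = v} : Finset W) rfl
  have hsplit : ∑ f ∈ Z, (#{x ∈ ({x | C.toFun x = v} : Finset W) |
      ∀ u ∈ {u ∈ A | 2 ≤ #(C.available S f u)}, ¬ C.graph.Adj x (f u)} : ℝ) ≤
      ∑ f ∈ Z, (#(C.available S f v) : ℝ) +
        ∑ f ∈ Z, (#{u ∈ A | ¬ 2 ≤ #(C.available S f u)} : ℝ) := by
    rw [← sum_add_distrib]
    refine sum_le_sum fun f hf => ?_
    rw [← Nat.cast_add, Nat.cast_le]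
    exact C.card_unblocked_le w₀ (fun u => 2 ≤ #(C.available S f u)) hA hf
  have hins : ∑ f ∈ Z, (#(C.available S f v) : ℝ) ≤ #(C.partialColorings w₀ (insert v S)) := by
    exact_mod_cast C.sum_card_available_le w₀ hv
  have hbad' : ∑ f ∈ Z, (#{u ∈ A | ¬ 2 ≤ #(C.available S f u)} : ℝ) ≤ √d * #Z := by
    refine le_of_mul_le_mul_left (hbad.trans_eq ?_) hsqrt
    rw [← mul_assoc, hsq]
  have hlow := mul_le_mul_of_nonneg_right (hq v) (Nat.cast_nonneg (α := ℝ) #Z)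
  linarith

lemma colorable_of_two_mul_sqrt_le (hG : G.CliqueFree 3) {d : ℕ} (hd : 0 < d)
    (hdeg : ∀ v, #{u | G.Adj v u} ≤ d)
    (hq : ∀ v, 2 * √d ≤ #{x | C.toFun x = v} * exp (-(2 * d / #{x | C.toFun x = v}))) :
    C.Colorable := by
  rcases isEmpty_or_nonempty V with hV | ⟨⟨v₀⟩⟩
  · exact ⟨∅, by simp [IsColoring]⟩
  have hsqrt : 0 < √(d : ℝ) := sqrt_pos.2 (by exact_mod_cast hd)
  obtain ⟨w₀⟩ : Nonempty W := by
    by_contra h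
    rw [not_nonempty_iff] at h
    have := hq v₀
    simp at this
    linarith
  have hpos : ∀ S : Finset V, 0 < #(C.partialColorings w₀ S) := fun S => by
    induction S using Finset.induction_on with
    | empty => exact card_pos.2 ⟨fun _ => w₀, by simp [mem_partialColorings]⟩
    | insert v S hv ih =>
      have hS : (0 : ℝ) < #(C.partialColorings w₀ S) := by exact_mod_cast ih
      exact_mod_cast (mul_pos hsqrt hS).trans_le
        (C.sqrt_mul_card_partialColorings_le w₀ hG hd hdeg hq S v hv)
  obtain ⟨f, hf⟩ := card_pos.1 (hpos univ)
  rw [mem_partialColorings] at hf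
  refine ⟨Set.range f, ?_, fun v => ⟨f v, ⟨v, rfl⟩, (hf.2 v (mem_univ v)).1⟩⟩
  rintro _ ⟨v, rfl⟩ _ ⟨u, rfl⟩
  exact (hf.2 v (mem_univ v)).2 u (mem_univ u)

end Cover

lemma two_mul_sqrt_le_mul_exp {d q : ℝ} (hd : 2 ≤ d) (hq : 8 * d / log d ≤ q) :
    2 * √d ≤ q * exp (-(2 * d / q)) := by
  have hd0 : 0 < d := by linarith
  have hlog : 0 < log d := log_pos (by linarith)
  have hq0 : 0 < q := (by positivity : 0 < 8 * d / log d).trans_le hq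
  have hexp : exp (-(log d / 4)) ≤ exp (-(2 * d / q)) := by
    rw [exp_le_exp, neg_le_neg_iff, div_le_div_iff₀ hq0 (by norm_num)]
    rw [div_le_iff₀ hlog] at hq
    linarith
  have hquarter : log d ≤ 4 * exp (log d / 4) := by
    linarith [add_one_le_exp (log d / 4)]
  have hsqrt : √d = exp (log d / 4) * exp (log d / 4) := by
    rw [← exp_add, sqrt_eq_rpow, rpow_def_of_pos hd0]
    ring_nf
  have hdexp : d = √d * √d := (mul_self_sqrt hd0.le).symm
  set e := exp (log d / 4) with he
  have he0 : 0 < e := exp_pos _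
  calc 2 * √d ≤ 8 * d / log d * exp (-(log d / 4)) := by
        rw [exp_neg, ← he, ← div_eq_mul_inv, div_div, le_div_iff₀ (by positivity)]
        have : 8 * d = 2 * √d * (4 * e * e) := by
          rw [mul_assoc 4, ← hsqrt]
          linarith
        rw [this]
        gcongr
    _ ≤ q * exp (-(2 * d / q)) := by gcongr

/-- **Theorem 3.** There is a constant `C > 0` such that every finite simple triangle-free
graph with maximum degree `Δ ≥ 2` satisfies `χ_c(G) ≤ C·Δ/ln Δ`. -/
theorem corrChromaticNumber_le_const_mul_of_triangleFree :
    ∃ C : ℝ, 0 < C ∧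
      ∀ (V : Type) [Fintype V] (G : SimpleGraph V) [DecidableRel G.Adj],
        G.CliqueFree 3 → 2 ≤ G.maxDegree →
        (corrChromaticNumber G : ℝ) ≤ C * G.maxDegree / Real.log G.maxDegree := by
  refine ⟨9, by norm_num, fun V _ G _ hG hΔ => ?_⟩
  set d := G.maxDegree with hd
  have hd2 : (2 : ℝ) ≤ d := by exact_mod_cast hΔ
  have hlog : 0 < log d := log_pos (by linarith)
  have hcorr : CorrColorable G ⌈8 * d / log d⌉₊ := by
    intro W _ C hC
    refine C.colorable_of_two_mul_sqrt_le hG (d := d) (by omega) (fun v => ?_) fun v => ?_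
    · have := G.degree_le_maxDegree v
      rw [← G.card_neighborFinset_eq_degree, G.neighborFinset_eq_filter] at this
      convert this
    · refine two_mul_sqrt_le_mul_exp hd2 (Nat.ceil_le.1 ?_)
      have := hC v
      rw [Fintype.card_subtype] at this
      exact this
  have hone : 1 ≤ d / log d := by
    rw [one_le_div hlog]
    linarith [log_le_sub_one_of_pos (by linarith : (0 : ℝ) < d)]
  calc (corrChromaticNumber G : ℝ) ≤ ⌈8 * (d : ℝ) / log d⌉₊ := Nat.cast_le.2 (Nat.sInf_le hcorr)
    _ ≤ 8 * d / log d + 1 := (Nat.ceil_lt_add_one (by positivity)).le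
    _ ≤ 9 * d / log d := by
        rw [mul_div_assoc, mul_div_assoc]
        linarith
end

section
/- There exist positive constants c and C such that for every d ≥ 6 and every finite simple d-regular triangle-free graph G, we have c·d/ln d ≤ χ_c(G) ≤ C·d/ln d, where χ_c denotes the correspondence chromatic number. -/
open Classical Finset Real

/-- A symmetric lopsided local lemma in counting form: if every event is rare within the
outcomes avoiding any set of events outside its neighborhood, then all events can be avoided. -/
theorem exists_forall_not_of_card_mul_le {Ω ι : Type*} {X : Finset Ω} (hX : X.Nonempty)
    (B : ι → Ω → Prop) (Γ : ι → Finset ι) {m : ℕ} (hm : 0 < m) (hΓ : ∀ i, #(Γ i) ≤ m)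
    (h : ∀ i T, Disjoint T (Γ i) →
      4 * m * #{ω ∈ X | B i ω ∧ ∀ j ∈ T, ¬ B j ω} ≤ #{ω ∈ X | ∀ j ∈ T, ¬ B j ω})
    (T : Finset ι) : ∃ ω ∈ X, ∀ j ∈ T, ¬ B j ω := by
  set N : Finset ι → ℝ := fun T => (#{ω ∈ X | ∀ j ∈ T, ¬ B j ω} : ℝ) with hN
  have hm' : (1 : ℝ) ≤ m := by exact_mod_cast hm
  set q : ℝ := 1 - 1 / (2 * m) with hq
  have hq0 : 0 < q := by
    have : 1 / (2 * (m : ℝ)) ≤ 1 / 2 := by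
      apply one_div_le_one_div_of_le <;> linarith
    linarith
  have hq1 : q ≤ 1 := by
    have : 0 ≤ 1 / (2 * (m : ℝ)) := by positivity
    linarith
  have hqm : 1 / 2 ≤ q ^ m := by
    have h1 := one_add_mul_le_pow (a := -(1 / (2 * (m : ℝ)))) (by linarith) m
    have h2 : 1 + (m : ℝ) * -(1 / (2 * m)) = 1 / 2 := by field_simp; norm_num
    rw [h2] at h1
    simpa [hq, sub_eq_add_neg] using h1
  have hinsert : ∀ i T, N (insert i T) = N T - #{ω ∈ X | B i ω ∧ ∀ j ∈ T, ¬ B j ω} := by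
    intro i T
    rw [eq_sub_iff_add_eq]
    simp only [hN]
    norm_cast
    rw [← card_union_of_disjoint]
    · congr 1
      ext ω
      simp only [mem_union, mem_filter, Finset.forall_mem_insert]
      tauto
    · rw [Finset.disjoint_left]
      simp only [mem_filter, Finset.forall_mem_insert]
      tauto
  have key : ∀ n, ∀ T : Finset ι, #T = n → ∀ i, q * N T ≤ N (insert i T) := by
    intro n
    induction n using Nat.strong_induction_on with
    | _ n ih =>
      intro T hT i
      have hchain : ∀ E : Finset ι, E ⊆ T ∩ Γ i → q ^ #E * N (T \ Γ i) ≤ N (T \ Γ i ∪ E) := by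
        intro E
        induction E using Finset.induction_on with
        | empty => simp
        | insert e E he ihE =>
          intro hE
          rw [Finset.insert_subset_iff] at hE
          have h1 := ihE hE.2
          have heT := Finset.mem_inter.1 hE.1
          have hlt : #(T \ Γ i ∪ E) < n := by
            rw [← hT]
            apply Finset.card_lt_card
            rw [Finset.ssubset_iff_of_subset]
            · exact ⟨e, heT.1, by simp [he, heT.2]⟩
            · exact Finset.union_subset Finset.sdiff_subset
                (hE.2.trans Finset.inter_subset_left)
          have h2 := ih _ hlt _ rfl e
          rw [Finset.card_insert_of_notMem he, Finset.union_insert, pow_succ']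
          calc q * q ^ #E * N (T \ Γ i) = q * (q ^ #E * N (T \ Γ i)) := by ring
            _ ≤ q * N (T \ Γ i ∪ E) := by gcongr
            _ ≤ _ := h2
      have h1 := hchain _ subset_rfl
      rw [Finset.sdiff_union_inter] at h1
      have hN0 : 0 ≤ N (T \ Γ i) := by positivity
      have h2 : q ^ m ≤ q ^ #(T ∩ Γ i) :=
        pow_le_pow_of_le_one hq0.le hq1
          ((Finset.card_le_card Finset.inter_subset_right).trans (hΓ i))
      have h3 : N (T \ Γ i) ≤ 2 * N T := by nlinarith
      have h4 : 4 * (m : ℝ) * (#{ω ∈ X | B i ω ∧ ∀ j ∈ T \ Γ i, ¬ B j ω} : ℝ) ≤ N (T \ Γ i) := by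
        simp only [hN]
        exact_mod_cast h i (T \ Γ i) Finset.sdiff_disjoint
      have h5 : (#{ω ∈ X | B i ω ∧ ∀ j ∈ T, ¬ B j ω} : ℝ) ≤
          #{ω ∈ X | B i ω ∧ ∀ j ∈ T \ Γ i, ¬ B j ω} := by
        gcongr
        exact Finset.sdiff_subset
      have h6 : (#{ω ∈ X | B i ω ∧ ∀ j ∈ T, ¬ B j ω} : ℝ) ≤ 1 / (2 * m) * N T := by
        rw [one_div, inv_mul_eq_div, le_div_iff₀ (by positivity)]
        nlinarith
      rw [hinsert, hq]
      linarith
  have hpos : 0 < N T := by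
    induction T using Finset.induction_on with
    | empty => simpa [hN] using hX.card_pos
    | insert e E he ihE => exact (mul_pos hq0 ihE).trans_le (key _ _ rfl e)
  simp only [hN, Nat.cast_pos, Finset.card_pos] at hpos
  obtain ⟨ω, hω⟩ := hpos
  exact ⟨ω, mem_filter.1 hω⟩

/-- Resampling one coordinate of a uniformly random element of a product. -/
theorem sum_piFinset_sum_update {V O : Type*} [Fintype V] (t : V → Finset O) (a : V)
    (F : (V → O) → ℝ) :
    ∑ g ∈ Fintype.piFinset t, ∑ o ∈ t a, F (Function.update g a o) =
      #(t a) * ∑ g ∈ Fintype.piFinset t, F g := by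
  rw [← nsmul_eq_mul, ← Finset.sum_const, Finset.sum_comm' (t' := t a)
    (s' := fun _ => Fintype.piFinset t) (by simp [and_comm]), ← Finset.sum_product',
    ← Finset.sum_product']
  refine Finset.sum_nbij' (fun x => (x.2 a, Function.update x.2 a x.1))
    (fun x => (x.2 a, Function.update x.2 a x.1)) ?_ ?_ ?_ ?_ ?_
  · rintro ⟨o, g⟩ h
    simp only [mem_product, Fintype.mem_piFinset] at h ⊢
    refine ⟨h.2 a, fun u => ?_⟩
    rcases eq_or_ne u a with rfl | hu
    · simpa using h.1
    · simpa [hu] using h.2 u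
  · rintro ⟨o, g⟩ h
    simp only [mem_product, Fintype.mem_piFinset] at h ⊢
    refine ⟨h.2 a, fun u => ?_⟩
    rcases eq_or_ne u a with rfl | hu
    · simpa using h.1
    · simpa [hu] using h.2 u
  · rintro ⟨o, g⟩ h
    simp
  · rintro ⟨o, g⟩ h
    simp
  · rintro ⟨o, g⟩ h
    simp

theorem one_add_sum_le_prod_one_add {κ : Type*} (s : Finset κ) {r : κ → ℝ}
    (hr : ∀ c ∈ s, 0 ≤ r c) : 1 + ∑ c ∈ s, r c ≤ ∏ c ∈ s, (1 + r c) := by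
  induction s using Finset.induction_on with
  | empty => simp
  | insert a s ha ih =>
    rw [Finset.forall_mem_insert] at hr
    have h1 := ih hr.2
    have h2 : 0 ≤ ∑ c ∈ s, r c := Finset.sum_nonneg hr.2
    rw [Finset.sum_insert ha, Finset.prod_insert ha]
    nlinarith [hr.1, mul_nonneg hr.1 h2]

theorem sum_prod_ite_le {O κ : Type*} [Fintype κ] {T : Finset O} (hT : T.Nonempty)
    (b : O → Option κ) {z : κ → ℝ} (hz : ∀ c, 0 < z c) (hz1 : ∀ c, z c ≤ 1) :
    ∑ o ∈ T, ∏ c, (if b o = some c then 1 else z c) ≤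
      #T * ∏ c, (z c + #{o ∈ T | b o = some c} / #T * (1 - z c)) := by
  have hT' : (0 : ℝ) < #T := by exact_mod_cast hT.card_pos
  set r : κ → ℝ := fun c => (z c)⁻¹ - 1 with hr
  have hr0 : ∀ c, 0 ≤ r c := fun c => sub_nonneg.2 ((one_le_inv₀ (hz c)).2 (hz1 c))
  have h1 : ∀ o, ∏ c, (if b o = some c then 1 else z c) =
      (∏ c, z c) * (1 + ∑ c, if b o = some c then r c else 0) := by
    intro o
    rcases hb : b o with _ | c₀
    · simp
    · have : ∏ c, (if some c₀ = some c then 1 else z c) =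
          ∏ c, z c * (if c₀ = c then (z c)⁻¹ else 1) := by
        refine Finset.prod_congr rfl fun c _ => ?_
        by_cases hc : c₀ = c
        · simp [hc, (hz c).ne']
        · simp [hc]
      rw [this, Finset.prod_mul_distrib]
      simp [hr]
  have h2 : ∏ c, (z c + #{o ∈ T | b o = some c} / #T * (1 - z c)) =
      (∏ c, z c) * ∏ c, (1 + #{o ∈ T | b o = some c} / #T * r c) := by
    rw [← Finset.prod_mul_distrib]
    refine Finset.prod_congr rfl fun c _ => ?_
    have := (hz c).ne'
    simp only [hr]
    field_simp
  have h3 : 1 + ∑ c, (#{o ∈ T | b o = some c} / #T * r c : ℝ) ≤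
      ∏ c, (1 + #{o ∈ T | b o = some c} / #T * r c) :=
    one_add_sum_le_prod_one_add _ fun c _ => mul_nonneg (by positivity) (hr0 c)
  have h4 : ∑ o ∈ T, (1 + ∑ c, if b o = some c then r c else 0) =
      #T * (1 + ∑ c, (#{o ∈ T | b o = some c} / #T * r c : ℝ)) := by
    rw [Finset.sum_add_distrib, Finset.sum_comm, mul_add, Finset.mul_sum]
    congr 1
    · simp
    · refine Finset.sum_congr rfl fun c _ => ?_
      rw [← Finset.sum_filter, Finset.sum_const, nsmul_eq_mul]
      field_simp
  simp_rw [h1]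
  rw [← Finset.mul_sum, h4, h2]
  have : 0 < ∏ c, z c := Finset.prod_pos fun c _ => hz c
  nlinarith [mul_le_mul_of_nonneg_left h3 (mul_pos hT' this).le]

/-- Negative correlation: when each coordinate `u` of a random element `g` of a product kills at
most one color `b u (g u)`, the survivals of the colors are negatively correlated. -/
theorem sum_piFinset_prod_le {V O κ : Type*} [Fintype V] [Fintype κ] {t : V → Finset O}
    (ht : ∀ u, (t u).Nonempty) (b : V → O → Option κ) (S : Finset V) {s : κ → ℝ}
    (hs0 : ∀ c, 0 ≤ s c) (hs1 : ∀ c, s c < 1) :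
    ∑ g ∈ Fintype.piFinset t, ∏ c, (1 - s c * if ∃ u ∈ S, b u (g u) = some c then 0 else 1) ≤
      #(Fintype.piFinset t) *
        ∏ c, (1 - s c * ∏ u ∈ S, (1 - #{o ∈ t u | b u o = some c} / #(t u) : ℝ)) := by
  induction S using Finset.induction_on generalizing s with
  | empty => simp
  | insert a S ha ih =>
    have hta : (0 : ℝ) < #(t a) := by exact_mod_cast (ht a).card_pos
    set y : κ → ℝ := fun c => ∏ u ∈ S, (1 - #{o ∈ t u | b u o = some c} / #(t u) : ℝ) with hy
    have hy1 : ∀ u c, (#{o ∈ t u | b u o = some c} / #(t u) : ℝ) ≤ 1 := fun u c =>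
      div_le_one_of_le₀ (by exact_mod_cast Finset.card_filter_le _ _) (by positivity)
    have hy0 : ∀ c, 0 ≤ y c := fun c => Finset.prod_nonneg fun u _ => sub_nonneg.2 (hy1 u c)
    have hyl : ∀ c, y c ≤ 1 := fun c => Finset.prod_le_one
      (fun u _ => sub_nonneg.2 (hy1 u c)) fun u _ => by
        have : (0 : ℝ) ≤ #{o ∈ t u | b u o = some c} / #(t u) := by positivity
        linarith
    have hz : ∀ c, 0 < 1 - s c * y c := fun c => by nlinarith [hs0 c, hs1 c, hy0 c, hyl c]
    have hz1 : ∀ c, 1 - s c * y c ≤ 1 := fun c => by nlinarith [hs0 c, hy0 c]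
    refine le_of_mul_le_mul_left ?_ hta
    rw [← sum_piFinset_sum_update, Finset.sum_comm]
    calc _ = ∑ o ∈ t a, ∑ g ∈ Fintype.piFinset t,
          ∏ c, (1 - (if b a o = some c then 0 else s c) *
            if ∃ u ∈ S, b u (g u) = some c then 0 else 1) := by
          refine Finset.sum_congr rfl fun o _ => Finset.sum_congr rfl fun g _ =>
            Finset.prod_congr rfl fun c _ => ?_
          have : (∃ u ∈ S, b u (Function.update g a o u) = some c) ↔
              ∃ u ∈ S, b u (g u) = some c := by
            refine exists_congr fun u => and_congr_right fun hu => ?_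
            rw [Function.update_of_ne (ne_of_mem_of_not_mem hu ha)]
          simp only [Finset.exists_mem_insert, this, Function.update_self]
          by_cases h : b a o = some c <;> simp [h]
      _ ≤ ∑ o ∈ t a, #(Fintype.piFinset t) *
          ∏ c, (1 - (if b a o = some c then 0 else s c) * y c) := by
          refine Finset.sum_le_sum fun o _ => ih ?_ ?_
          · intro c; split_ifs <;> simp [hs0]
          · intro c; split_ifs <;> simp [hs1]
      _ = #(Fintype.piFinset t) *
          ∑ o ∈ t a, ∏ c, (if b a o = some c then 1 else 1 - s c * y c) := by
          rw [← Finset.mul_sum]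
          congr 1
          refine Finset.sum_congr rfl fun o _ => Finset.prod_congr rfl fun c _ => ?_
          split_ifs <;> simp
      _ ≤ #(Fintype.piFinset t) * (#(t a) * _) := by
          gcongr
          exact sum_prod_ite_le (ht a) (b a) hz hz1
      _ = _ := by
          rw [mul_left_comm]
          congr 2
          refine Finset.prod_congr rfl fun c _ => ?_
          rw [Finset.prod_insert ha]
          ring

section Relation

variable {V κ : Type*} [Fintype V] [Fintype κ]

/-- Partial colorings of `S` from the lists `A` without conflicts with respect to `R`. -/
noncomputable def listColorings (R : V → κ → V → κ → Prop) (A : V → Finset κ) (S : Finset V) :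
    Finset (V → Option κ) :=
  {g | (∀ v ∉ S, g v = none) ∧ (∀ v ∈ S, ∃ c ∈ A v, g v = some c) ∧
    ∀ u v i j, g u = some i → g v = some j → ¬ R u i v j}

variable {R : V → κ → V → κ → Prop}

theorem update_some_mem_listColorings (hsymm : ∀ u i v j, R u i v j → R v j u i)
    (hirr : ∀ v i j, ¬ R v i v j)
    {A : V → Finset κ} {S : Finset V} {v : V}
    {g : V → Option κ} (hg : g ∈ listColorings R A S) {c : κ} (hc : c ∈ A v)
    (hR : ∀ u j, g u = some j → ¬ R v c u j) :
    Function.update g v (some c) ∈ listColorings R A (insert v S) := by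
  simp only [listColorings, mem_filter, mem_univ, true_and] at hg ⊢
  refine ⟨fun u hu => ?_, fun u hu => ?_, fun u w i j hi hj => ?_⟩
  · rw [Finset.mem_insert, not_or] at hu
    rw [Function.update_of_ne hu.1, hg.1 u hu.2]
  · rcases eq_or_ne u v with rfl | huv
    · exact ⟨c, hc, by simp⟩
    · rw [Function.update_of_ne huv]
      exact hg.2.1 u ((Finset.mem_insert.1 hu).resolve_left huv)
  · rcases eq_or_ne u v with rfl | huv
    · rcases eq_or_ne w u with rfl | hwv
      · exact hirr _ _ _
      · rw [Function.update_self, Option.some_inj] at hi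
        rw [Function.update_of_ne hwv] at hj
        exact hi ▸ hR w j hj
    · rw [Function.update_of_ne huv] at hi
      rcases eq_or_ne w v with rfl | hwv
      · rw [Function.update_self, Option.some_inj] at hj
        exact fun h => hR u i hi (hj ▸ hsymm _ _ _ _ h)
      · rw [Function.update_of_ne hwv] at hj
        exact hg.2.2 u w i j hi hj

theorem update_none_mem_listColorings {A : V → Finset κ} {S : Finset V} (u : V)
    {g : V → Option κ} (hg : g ∈ listColorings R A S) :
    Function.update g u none ∈ listColorings R A (S.erase u) := by
  simp only [listColorings, mem_filter, mem_univ, true_and] at hg ⊢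
  have key : ∀ w i, Function.update g u none w = some i → g w = some i := by
    intro w i h
    rcases eq_or_ne w u with rfl | hw
    · simp at h
    · rwa [Function.update_of_ne hw] at h
  refine ⟨fun w hw => ?_, fun w hw => ?_, fun w x i j hi hj =>
    hg.2.2 w x i j (key _ _ hi) (key _ _ hj)⟩
  · rcases eq_or_ne w u with rfl | hwu
    · simp
    · rw [Function.update_of_ne hwu]
      exact hg.1 w fun h => hw (Finset.mem_erase.2 ⟨hwu, h⟩)
  · rw [Finset.mem_erase] at hw
    rw [Function.update_of_ne hw.1]
    exact hg.2.1 w hw.2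

theorem card_listColorings_conflict_le {A : V → Finset κ} {S : Finset V} (u v : V) (c : κ)
    (hmatch : ∀ u i v j j', R u i v j → R u i v j' → j = j') :
    #{g ∈ listColorings R A S | ∃ j, g u = some j ∧ R v c u j} ≤
      #(listColorings R A (S.erase u)) := by
  refine Finset.card_le_card_of_injOn (fun g => Function.update g u none) ?_ ?_
  · intro g hg
    exact update_none_mem_listColorings u (mem_filter.1 hg).1
  · intro g hg g' hg' h
    obtain ⟨-, j, hj, hRj⟩ := mem_filter.1 hg
    obtain ⟨-, j', hj', hRj'⟩ := mem_filter.1 hg'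
    ext1 w
    rcases eq_or_ne w u with rfl | hw
    · rw [hj, hj', hmatch _ _ _ _ _ hRj hRj']
    · simpa [hw] using congrFun h w

/-- A coloring from lists of size `4D` exists when every color conflicts with at most `D`
neighboring colors, by Rosenfeld's counting argument. -/
theorem exists_listColoring (hsymm : ∀ u i v j, R u i v j → R v j u i)
    (hirr : ∀ v i j, ¬ R v i v j)
    (hmatch : ∀ u i v j j', R u i v j → R u i v j' → j = j')
    {D : ℕ} (hD : 0 < D) (A : V → Finset κ) (U : Finset V) (hA : ∀ v ∈ U, 4 * D ≤ #(A v))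
    (hdeg : ∀ v ∈ U, ∀ c ∈ A v, #{u ∈ U | ∃ j ∈ A u, R v c u j} ≤ D) :
    (listColorings R A U).Nonempty := by
  have key : ∀ n, ∀ S : Finset V, S ⊆ U → #S = n → ∀ v ∈ U, v ∉ S →
      2 * D * #(listColorings R A S) ≤ #(listColorings R A (insert v S)) := by
    intro n
    induction n using Nat.strong_induction_on with
    | _ n ih =>
      intro S hS hn v hv hvS
      set P := #(listColorings R A S) with hP
      have hext : #{x ∈ listColorings R A S ×ˢ A v | ∀ u j, x.1 u = some j → ¬ R v x.2 u j} ≤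
          #(listColorings R A (insert v S)) := by
        refine Finset.card_le_card_of_injOn (fun x => Function.update x.1 v (some x.2)) ?_ ?_
        · rintro ⟨g, c⟩ hx
          simp only [coe_filter, mem_product, Set.mem_ofPred_eq] at hx
          exact update_some_mem_listColorings hsymm hirr hx.1.1 hx.1.2 hx.2
        · rintro ⟨g, c⟩ hx ⟨g', c'⟩ hx' h
          simp only [coe_filter, mem_product, Set.mem_ofPred_eq, listColorings, mem_filter,
            mem_univ, true_and] at hx hx'
          have hc : c = c' := by simpa using congrFun h v
          refine Prod.ext ?_ hc
          ext1 w
          rcases eq_or_ne w v with rfl | hw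
          · exact (hx.1.1.1 w hvS).trans (hx'.1.1.1 w hvS).symm
          · simpa [hw] using congrFun h w
      have hsplit := Finset.card_filter_add_card_filter_not (s := listColorings R A S ×ˢ A v)
        (fun x => ∀ u j, x.1 u = some j → ¬ R v x.2 u j)
      have hbad : #{x ∈ listColorings R A S ×ˢ A v |
          ¬ ∀ u j, x.1 u = some j → ¬ R v x.2 u j} ≤ ∑ c ∈ A v,
            ∑ u ∈ U with ∃ j ∈ A u, R v c u j,
              #{g ∈ listColorings R A S | ∃ j, g u = some j ∧ R v c u j} := by
        have hsub : {x ∈ listColorings R A S ×ˢ A v |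
            ¬ ∀ u j, x.1 u = some j → ¬ R v x.2 u j} ⊆ (A v).biUnion fun c =>
              ({u ∈ U | ∃ j ∈ A u, R v c u j} : Finset V).biUnion fun u =>
                {g ∈ listColorings R A S | ∃ j, g u = some j ∧ R v c u j} ×ˢ {c} := by
          rintro ⟨g, c⟩ hx
          simp only [mem_filter, mem_product, not_forall, not_not] at hx
          obtain ⟨⟨hg, hc⟩, u, j, hj, hR⟩ := hx
          have hg' := hg
          simp only [listColorings, mem_filter, mem_univ, true_and] at hg'
          have huS : u ∈ S := by
            by_contra huS
            rw [hg'.1 u huS] at hj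
            cases hj
          obtain ⟨j', hj'A, hj'⟩ := hg'.2.1 u huS
          have hjj : j' = j := Option.some_inj.1 (hj'.symm.trans hj)
          simp only [mem_biUnion, mem_filter, mem_product, mem_singleton]
          exact ⟨c, hc, u, ⟨hS huS, j, hjj ▸ hj'A, hR⟩, ⟨hg, j, hj, hR⟩, rfl⟩
        refine (Finset.card_le_card hsub).trans (Finset.card_biUnion_le.trans
          (Finset.sum_le_sum fun c _ => Finset.card_biUnion_le.trans
            (Finset.sum_le_sum fun u _ => ?_)))
        simp
      have hone : ∀ c ∈ A v, ∀ u ∈ U, 2 * D *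
          #{g ∈ listColorings R A S | ∃ j, g u = some j ∧ R v c u j} ≤ P := by
        intro c _ u hu
        by_cases huS : u ∈ S
        · have h1 := card_listColorings_conflict_le (A := A) (S := S) u v c hmatch
          have h2 := ih _ (hn ▸ Finset.card_erase_lt_of_mem huS) (S.erase u)
            ((Finset.erase_subset _ _).trans hS) rfl u hu (Finset.notMem_erase _ _)
          rw [Finset.insert_erase huS] at h2
          exact (Nat.mul_le_mul_left _ h1).trans h2
        · rw [Finset.card_eq_zero.2, mul_zero]
          · exact Nat.zero_le _
          · rw [Finset.filter_eq_empty_iff]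
            rintro g hg ⟨j, hj, -⟩
            simp only [listColorings, mem_filter, mem_univ, true_and] at hg
            rw [hg.1 u huS] at hj
            cases hj
      have hbad2 : 2 * D * #{x ∈ listColorings R A S ×ˢ A v |
          ¬ ∀ u j, x.1 u = some j → ¬ R v x.2 u j} ≤ #(A v) * (D * P) := by
        refine (Nat.mul_le_mul_left _ hbad).trans ?_
        rw [Finset.mul_sum, ← smul_eq_mul #(A v)]
        refine Finset.sum_le_card_nsmul _ _ _ fun c hc => ?_
        rw [Finset.mul_sum]
        refine (Finset.sum_le_card_nsmul _ _ P fun u hu =>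
          hone c hc u (mem_filter.1 hu).1).trans ?_
        exact Nat.mul_le_mul_right _ (hdeg v hv c hc)
      have hbad3 : 2 * #{x ∈ listColorings R A S ×ˢ A v |
          ¬ ∀ u j, x.1 u = some j → ¬ R v x.2 u j} ≤ #(A v) * P :=
        Nat.le_of_mul_le_mul_left (by linarith) hD
      rw [Finset.card_product, ← hP] at hsplit
      have := Nat.mul_le_mul_right P (hA v hv)
      linarith
  have hind : ∀ S ⊆ U, (listColorings R A S).Nonempty := by
    intro S
    induction S using Finset.induction_on with
    | empty => exact fun _ => ⟨fun _ => none, by simp [listColorings]⟩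
    | insert a S ha ih =>
      intro h
      rw [Finset.insert_subset_iff] at h
      have h1 := key _ S h.2 rfl a h.1 ha
      have h2 := (ih h.2).card_pos
      exact Finset.card_pos.1 ((by positivity : 0 < 2 * D * _).trans_le h1)
  exact hind U subset_rfl

end Relation

/-- In a random element `g` of a product in which each coordinate kills at most one color and
may kill none, it is unlikely that fewer than `l` colors survive. -/
theorem card_filter_survivors_lt_le {V O κ : Type*} [Fintype V] [Fintype κ] [Nonempty κ]
    {t : V → Finset O} (ht : ∀ u, (t u).Nonempty) (b : V → O → Option κ) {S : Finset V} {d : ℕ}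
    (hd : #S ≤ d) (hnone : ∀ u ∈ S, ∃ o ∈ t u, b u o = none)
    (hone : ∀ u ∈ S, ∀ c, #{o ∈ t u | b u o = some c} ≤ 1) (l : ℕ) :
    (#{g ∈ Fintype.piFinset t | #{c | ¬ ∃ u ∈ S, b u (g u) = some c} < l} : ℝ) ≤
      2 ^ l * exp (-(Fintype.card κ / 2 * exp (-(2 * d / Fintype.card κ)))) *
        #(Fintype.piFinset t) := by
  set k : ℝ := ((Fintype.card κ : ℕ) : ℝ) with hk
  have hk0 : 0 < k := by simp only [hk]; exact_mod_cast Fintype.card_pos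
  set p : V → κ → ℝ := fun u c => #{o ∈ t u | b u o = some c} / #(t u) with hp
  have htpos : ∀ u, (0 : ℝ) < #(t u) := fun u => by exact_mod_cast (ht u).card_pos
  have hp0 : ∀ u c, 0 ≤ p u c := fun u c => by positivity
  have hphalf : ∀ u ∈ S, ∀ c, p u c ≤ 1 / 2 := by
    intro u hu c
    obtain ⟨o, ho, hbo⟩ := hnone u hu
    have h1 : #{o ∈ t u | b u o = some c} < #(t u) := by
      apply Finset.card_lt_card
      rw [Finset.ssubset_iff_of_subset (Finset.filter_subset _ _)]
      exact ⟨o, ho, by simp [hbo]⟩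
    have h2 := hone u hu c
    have h3 : (2 * #{o ∈ t u | b u o = some c} : ℝ) ≤ #(t u) := by
      have : 2 * #{o ∈ t u | b u o = some c} ≤ #(t u) := by omega
      exact_mod_cast this
    simp only [hp]
    rw [div_le_div_iff₀ (htpos u) two_pos]
    linarith
  have hpsum : ∀ u, ∑ c, p u c ≤ 1 := by
    intro u
    simp only [hp]
    rw [← Finset.sum_div, div_le_one (htpos u)]
    have : ∑ c, #{o ∈ t u | b u o = some c} ≤ #(t u) := by
      rw [← Finset.card_biUnion]
      · exact Finset.card_le_card (Finset.biUnion_subset.2 fun c _ => Finset.filter_subset _ _)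
      · intro c _ c' _ hcc
        rw [Function.onFun, Finset.disjoint_left]
        intro o ho ho'
        exact hcc (Option.some_inj.1 ((mem_filter.1 ho).2.symm.trans (mem_filter.1 ho').2))
    exact_mod_cast this
  set y : κ → ℝ := fun c => ∏ u ∈ S, (1 - p u c) with hy
  have hy1 : ∀ c, exp (-(2 * ∑ u ∈ S, p u c)) ≤ y c := by
    intro c
    rw [Finset.mul_sum, ← Finset.sum_neg_distrib, Real.exp_sum]
    refine Finset.prod_le_prod (fun u _ => (exp_pos _).le) fun u hu => ?_
    have h1 := hphalf u hu c
    have h2 := hp0 u c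
    have h3 := add_one_le_exp (2 * p u c)
    rw [Real.exp_neg, inv_le_iff_one_le_mul₀ (exp_pos _)]
    nlinarith
  have hysum : k * exp (-(2 * d / k)) ≤ ∑ c, y c := by
    have h1 : ∀ c, exp (-(2 * d / k)) * (1 + (2 * d / k - 2 * ∑ u ∈ S, p u c)) ≤ y c := by
      intro c
      refine le_trans ?_ (hy1 c)
      have h2 := add_one_le_exp (2 * d / k - 2 * ∑ u ∈ S, p u c)
      calc _ ≤ exp (-(2 * d / k)) * exp (2 * d / k - 2 * ∑ u ∈ S, p u c) := by
            gcongr; linarith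
        _ = _ := by rw [← Real.exp_add]; congr 1; ring
    refine le_trans ?_ (Finset.sum_le_sum fun c _ => h1 c)
    rw [← Finset.mul_sum, Finset.sum_add_distrib, Finset.sum_sub_distrib, ← Finset.mul_sum,
      Finset.sum_comm]
    have h2 : ∑ u ∈ S, ∑ c, p u c ≤ d := by
      refine (Finset.sum_le_card_nsmul _ _ 1 fun u _ => hpsum u).trans ?_
      simpa using hd
    simp only [Finset.sum_const, Finset.card_univ, nsmul_eq_mul, mul_one, ← hk]
    have h3 : k * (2 * d / k) = 2 * d := by field_simp
    rw [h3, mul_comm]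
    gcongr
    linarith
  have hmain := sum_piFinset_prod_le ht b S (s := fun _ => 1 / 2) (by norm_num) (by norm_num)
  have hlow : (#{g ∈ Fintype.piFinset t | #{c | ¬ ∃ u ∈ S, b u (g u) = some c} < l} : ℝ) *
      (1 / 2) ^ l ≤ ∑ g ∈ Fintype.piFinset t,
        ∏ c, (1 - 1 / 2 * if ∃ u ∈ S, b u (g u) = some c then 0 else 1 : ℝ) := by
    have heq : ∀ g : V → O,
        ∏ c, (1 - 1 / 2 * if ∃ u ∈ S, b u (g u) = some c then 0 else 1 : ℝ) =
          (1 / 2) ^ #{c | ¬ ∃ u ∈ S, b u (g u) = some c} := by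
      intro g
      rw [← Finset.prod_const, Finset.prod_filter]
      refine Finset.prod_congr rfl fun c _ => ?_
      by_cases h : ∃ u ∈ S, b u (g u) = some c
      · simp only [h, not_true]; norm_num
      · simp only [h, not_false_iff]; norm_num
    simp_rw [heq]
    rw [← nsmul_eq_mul, ← Finset.sum_const]
    refine (Finset.sum_le_sum fun g hg => ?_).trans
      (Finset.sum_le_sum_of_subset_of_nonneg (Finset.filter_subset _ _)
        fun g _ _ => by positivity)
    exact pow_le_pow_of_le_one (by norm_num) (by norm_num) (mem_filter.1 hg).2.le
  have hup : ∏ c, (1 - 1 / 2 * y c) ≤ exp (-(k / 2 * exp (-(2 * d / k)))) := by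
    calc ∏ c, (1 - 1 / 2 * y c) ≤ ∏ c, exp (-(1 / 2 * y c)) := by
          refine Finset.prod_le_prod (fun c _ => ?_) fun c _ => ?_
          · have : y c ≤ 1 := Finset.prod_le_one
              (fun u hu => by linarith [hphalf u hu c]) fun u _ => by linarith [hp0 u c]
            linarith
          · linarith [add_one_le_exp (-(1 / 2 * y c))]
      _ = exp (-(1 / 2 * ∑ c, y c)) := by
          rw [← Real.exp_sum, Finset.sum_neg_distrib, Finset.mul_sum]
      _ ≤ _ := by
          apply exp_le_exp.2
          linarith
  have h2 : (1 / 2 : ℝ) ^ l * 2 ^ l = 1 := by rw [← mul_pow]; norm_num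
  have h3 := hlow.trans (hmain.trans
    (mul_le_mul_of_nonneg_left hup (Nat.cast_nonneg (#(Fintype.piFinset t)))))
  have h4 := mul_le_mul_of_nonneg_right h3 (pow_nonneg two_pos.le l : (0 : ℝ) ≤ 2 ^ l)
  rw [mul_assoc, h2, mul_one] at h4
  exact h4.trans_eq (by ring)

theorem SimpleGraph.CliqueFree.not_adj_of_adj_of_adj {V : Type*} {G : SimpleGraph V}
    (hG : G.CliqueFree 3) {u v w : V} (hu : G.Adj v u) (hw : G.Adj v w) : ¬ G.Adj u w := fun h =>
  hG {v, u, w} (SimpleGraph.is3Clique_triple_iff.2 ⟨hu, hw, h⟩)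

section Relation

variable {V κ : Type*} [Fintype V] [Fintype κ]

/-- Partial colorings (`none` means uncolored) without conflicts with respect to `R`. -/
noncomputable def partialColorings (R : V → κ → V → κ → Prop) : Finset (V → Option κ) :=
  {f | ∀ u v i j, f u = some i → f v = some j → ¬ R u i v j}

/-- The colors of `v` without conflicts with the partial coloring `f`. -/
noncomputable def availableColors (R : V → κ → V → κ → Prop) (f : V → Option κ) (v : V) :
    Finset κ :=
  {c | ∀ u j, f u = some j → ¬ R v c u j}

/-- The uncolored vertices having an available color in conflict with the color `c` of `v`. -/
noncomputable def blankConflicts (R : V → κ → V → κ → Prop) (f : V → Option κ) (v : V) (c : κ) :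
    Finset V :=
  {u | f u = none ∧ ∃ j ∈ availableColors R f u, R v c u j}

/-- The vertex `v` is uncolored and has few available colors or an available color with many
conflicts. -/
def IsFlaw (R : V → κ → V → κ → Prop) (D : ℕ) (v : V) (f : V → Option κ) : Prop :=
  f v = none ∧ (#(availableColors R f v) < 4 * D ∨
    ∃ c ∈ availableColors R f v, D < #(blankConflicts R f v c))

/-- The possible values at `u` when the neighborhood of `v` is recolored. -/
noncomputable def recolorings (R : V → κ → V → κ → Prop) (G : SimpleGraph V)
    (h : V → Option κ) (v u : V) : Finset (Option κ) :=
  if G.Adj v u then insertNone (availableColors R h u) else {h u}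

variable {R : V → κ → V → κ → Prop} {G : SimpleGraph V}

theorem recolorings_nonempty (h : V → Option κ) (v u : V) : (recolorings R G h v u).Nonempty := by
  unfold recolorings
  split_ifs
  · exact insertNone_nonempty
  · exact singleton_nonempty _

theorem eq_of_mem_recolorings {h f : V → Option κ} {v : V}
    (hf : f ∈ Fintype.piFinset (recolorings R G h v)) {u : V} (hu : ¬ G.Adj v u) : f u = h u := by
  have := Fintype.mem_piFinset.1 hf u
  simpa [recolorings, hu] using this

theorem availableColors_congr (hadj : ∀ u i v j, R u i v j → G.Adj u v) {f f' : V → Option κ}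
    {u : V} (h : ∀ x, G.Adj u x → f x = f' x) :
    availableColors R f u = availableColors R f' u := by
  ext c
  simp only [availableColors, mem_filter, mem_univ, true_and]
  refine forall_congr' fun x => forall_congr' fun j => ?_
  by_cases hx : G.Adj u x
  · rw [h x hx]
  · exact ⟨fun _ _ hR => hx (hadj _ _ _ _ hR), fun _ _ hR => hx (hadj _ _ _ _ hR)⟩

theorem IsFlaw.congr (hadj : ∀ u i v j, R u i v j → G.Adj u v) {f f' : V → Option κ} {D : ℕ}
    {w : V} (hw : f w = f' w) (h₁ : ∀ x, G.Adj w x → f x = f' x)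
    (h₂ : ∀ y x, G.Adj w y → G.Adj y x → f x = f' x) (h : IsFlaw R D w f) : IsFlaw R D w f' := by
  have ha := availableColors_congr hadj h₁
  have hb : ∀ c, blankConflicts R f w c = blankConflicts R f' w c := by
    intro c
    ext u
    simp only [blankConflicts, mem_filter, mem_univ, true_and]
    by_cases hu : G.Adj w u
    · rw [h₁ u hu, availableColors_congr hadj fun x hx => h₂ u x hu hx]
    · exact ⟨fun ⟨_, _, _, hR⟩ => (hu (hadj _ _ _ _ hR)).elim,
        fun ⟨_, _, _, hR⟩ => (hu (hadj _ _ _ _ hR)).elim⟩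
  simpa only [IsFlaw, hw, ha, hb] using h

theorem mem_piFinset_recolorings (hsymm : ∀ u i v j, R u i v j → R v j u i)
    (hadj : ∀ u i v j, R u i v j → G.Adj u v) (hG : G.CliqueFree 3) {h f : V → Option κ} {v : V}
    (hh : h ∈ partialColorings R) (hv : ∀ u, G.Adj v u → h u = none) :
    f ∈ Fintype.piFinset (recolorings R G h v) ↔
      f ∈ partialColorings R ∧ ∀ u, ¬ G.Adj v u → f u = h u := by
  simp only [partialColorings, mem_filter, mem_univ, true_and] at hh ⊢
  refine ⟨fun hf => ⟨?_, fun u => eq_of_mem_recolorings hf⟩, fun ⟨hf, hfh⟩ => ?_⟩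
  · have hmem : ∀ u i, G.Adj v u → f u = some i → i ∈ availableColors R h u := by
      intro u i hu hi
      have := Fintype.mem_piFinset.1 hf u
      rwa [recolorings, if_pos hu, hi, some_mem_insertNone] at this
    have key : ∀ u w i j, f u = some i → f w = some j → G.Adj v u → ¬ G.Adj v w →
        ¬ R u i w j := by
      intro u w i j hi hj hu hw
      have := hmem u i hu hi
      simp only [availableColors, mem_filter, mem_univ, true_and] at this
      exact this w j (eq_of_mem_recolorings hf hw ▸ hj)
    intro u w i j hi hj hR
    by_cases hu : G.Adj v u <;> by_cases hw : G.Adj v w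
    · exact hG.not_adj_of_adj_of_adj hu hw (hadj _ _ _ _ hR)
    · exact key u w i j hi hj hu hw hR
    · exact key w u j i hj hi hw hu (hsymm _ _ _ _ hR)
    · rw [eq_of_mem_recolorings hf hu] at hi
      rw [eq_of_mem_recolorings hf hw] at hj
      exact hh u w i j hi hj hR
  · rw [Fintype.mem_piFinset]
    intro u
    by_cases hu : G.Adj v u
    · rw [recolorings, if_pos hu, mem_insertNone]
      intro i hi
      simp only [availableColors, mem_filter, mem_univ, true_and]
      intro w j hj
      refine hf u w i j hi ?_
      rw [hfh w, hj]
      intro hw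
      rw [hv w hw] at hj
      cases hj
    · simp [recolorings, hu, hfh u hu]

theorem availableColors_eq_of_mem_recolorings (hadj : ∀ u i v j, R u i v j → G.Adj u v)
    (hG : G.CliqueFree 3) {h f : V → Option κ} {v : V}
    (hf : f ∈ Fintype.piFinset (recolorings R G h v)) {u : V} (hu : G.Adj v u) :
    availableColors R f u = availableColors R h u :=
  availableColors_congr hadj fun _ hx =>
    eq_of_mem_recolorings hf fun hx' => hG.not_adj_of_adj_of_adj hu hx' hx

/-- Among the recolorings of the neighborhood of `v`, few leave the color `c` of `v` available
with more than `D` conflicts: a neighbor is as likely to be uncolored as to block `c`. -/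
theorem card_filter_lt_blankConflicts_mul_le
    (hmatch : ∀ u i v j j', R u i v j → R u i v j' → j = j')
    (hadj : ∀ u i v j, R u i v j → G.Adj u v) (hG : G.CliqueFree 3) (h : V → Option κ) (v : V)
    (c : κ) (D : ℕ) :
    #{f ∈ Fintype.piFinset (recolorings R G h v) |
        c ∈ availableColors R f v ∧ D < #(blankConflicts R f v c)} * 2 ^ D ≤
      #(Fintype.piFinset (recolorings R G h v)) := by
  set M : Finset V := {u | ∃ j ∈ availableColors R h u, R v c u j} with hM
  set w : V → Option κ → ℕ := fun u o => if u ∈ M then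
    o.elim 2 fun j => if R v c u j then 0 else 1 else 1 with hw
  have hsum : ∀ u, ∑ o ∈ recolorings R G h v u, w u o = #(recolorings R G h v u) := by
    intro u
    by_cases hu : u ∈ M
    · obtain ⟨j, hj, hR⟩ := (mem_filter.1 hu).2
      have hone : #{i ∈ availableColors R h u | R v c u i} = 1 := by
        rw [Finset.card_eq_one]
        refine ⟨j, ?_⟩
        ext i
        simp only [mem_filter, mem_singleton]
        exact ⟨fun hi => hmatch _ _ _ _ _ hi.2 hR, fun hi => hi ▸ ⟨hj, hR⟩⟩
      have hsplit := Finset.card_filter_add_card_filter_not (s := availableColors R h u)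
        (fun i => R v c u i)
      rw [recolorings, if_pos (hadj _ _ _ _ hR), Finset.sum_insertNone, card_insertNone]
      simp only [hw, hu, if_true, Option.elim]
      have : ∑ i ∈ availableColors R h u, (if R v c u i then 0 else 1) =
          #{i ∈ availableColors R h u | ¬ R v c u i} := by
        rw [Finset.card_filter]
        exact Finset.sum_congr rfl fun i _ => by split_ifs <;> simp_all
      omega
    · simp [hw, hu]
  have hle : ∀ f ∈ Fintype.piFinset (recolorings R G h v), c ∈ availableColors R f v →
      D < #(blankConflicts R f v c) → 2 ^ D ≤ ∏ u, w u (f u) := by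
    intro f hf hc hD
    calc 2 ^ D ≤ 2 ^ #(blankConflicts R f v c) := Nat.pow_le_pow_right two_pos hD.le
      _ = ∏ u, if u ∈ blankConflicts R f v c then 2 else 1 := by
        rw [← Finset.prod_const, ← Finset.prod_filter]
        congr 1
        ext; simp
      _ ≤ _ := by
        refine Finset.prod_le_prod' fun u _ => ?_
        by_cases hu : u ∈ blankConflicts R f v c
        · have hu' := hu
          simp only [blankConflicts, mem_filter, mem_univ, true_and] at hu'
          obtain ⟨hblank, j, hj, hR⟩ := hu'
          rw [availableColors_eq_of_mem_recolorings hadj hG hf (hadj _ _ _ _ hR)] at hj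
          have huM : u ∈ M := mem_filter.2 ⟨mem_univ _, j, hj, hR⟩
          simp [hw, hu, huM, hblank]
        · simp only [availableColors, mem_filter, mem_univ, true_and] at hc
          simp only [hu, if_false, hw]
          split_ifs with huM
          · rcases hfu : f u with _ | j
            · simp
            · simp [hc u j hfu]
          · exact le_rfl
  calc _ = ∑ f ∈ Fintype.piFinset (recolorings R G h v) with
        c ∈ availableColors R f v ∧ D < #(blankConflicts R f v c), 2 ^ D := by simp
    _ ≤ ∑ f ∈ Fintype.piFinset (recolorings R G h v) with
        c ∈ availableColors R f v ∧ D < #(blankConflicts R f v c), ∏ u, w u (f u) :=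
      Finset.sum_le_sum fun f hf => by
        rw [mem_filter] at hf
        exact hle f hf.1 hf.2.1 hf.2.2
    _ ≤ ∑ f ∈ Fintype.piFinset (recolorings R G h v), ∏ u, w u (f u) :=
      Finset.sum_le_sum_of_subset (Finset.filter_subset _ _)
    _ = _ := by
      rw [← Finset.prod_univ_sum, Fintype.card_piFinset]
      exact Finset.prod_congr rfl fun u _ => hsum u

/-- Among the recolorings of the neighborhood of `v`, few leave `v` with few colors. -/
theorem card_filter_card_availableColors_lt_le [Nonempty κ]
    (hsymm : ∀ u i v j, R u i v j → R v j u i)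
    (hmatch : ∀ u i v j j', R u i v j → R u i v j' → j = j')
    (hadj : ∀ u i v j, R u i v j → G.Adj u v) (h : V → Option κ) (v : V) {d : ℕ}
    (hd : #{u | G.Adj v u} ≤ d) (l : ℕ) :
    (#{f ∈ Fintype.piFinset (recolorings R G h v) | #(availableColors R f v) < l} : ℝ) ≤
      2 ^ l * exp (-(Fintype.card κ / 2 * exp (-(2 * d / Fintype.card κ)))) *
        #(Fintype.piFinset (recolorings R G h v)) := by
  set b : V → Option κ → Option κ := fun u o =>
    o.bind fun j => if hj : ∃ c, R v c u j then some hj.choose else none with hb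
  have hbiff : ∀ u o c, b u o = some c ↔ ∃ j, o = some j ∧ R v c u j := by
    intro u o c
    simp only [hb, Option.bind_eq_some_iff]
    refine exists_congr fun j => and_congr_right fun _ => ?_
    split_ifs with hj
    · rw [Option.some_inj]
      exact ⟨fun h => h ▸ hj.choose_spec, fun h =>
        hmatch _ _ _ _ _ (hsymm _ _ _ _ hj.choose_spec) (hsymm _ _ _ _ h)⟩
    · exact ⟨nofun, fun h => (hj ⟨c, h⟩).elim⟩
  have hav : ∀ f : V → Option κ, availableColors R f v =
      ({c | ¬ ∃ u ∈ ({u | G.Adj v u} : Finset V), b u (f u) = some c} : Finset κ) := by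
    intro f
    ext c
    simp only [availableColors, mem_filter, mem_univ, true_and, hbiff]
    constructor
    · rintro H ⟨u, -, j, hj, hR⟩
      exact H u j hj hR
    · intro H u j hj hR
      exact H ⟨u, hadj _ _ _ _ hR, j, hj, hR⟩
  simp_rw [hav]
  refine card_filter_survivors_lt_le (recolorings_nonempty h v) b hd ?_ ?_ l
  · intro u hu
    have hu' : G.Adj v u := (mem_filter.1 hu).2
    exact ⟨none, by simp [recolorings, hu'], rfl⟩
  · intro u _ c
    rw [Finset.card_le_one]
    intro o ho o' ho'
    obtain ⟨j, rfl, hj⟩ := (hbiff _ _ _).1 (mem_filter.1 ho).2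
    obtain ⟨j', rfl, hj'⟩ := (hbiff _ _ _).1 (mem_filter.1 ho').2
    rw [hmatch _ _ _ _ _ hj hj']

end Relation

section Relation

variable {V κ : Type*} [Fintype V] [Fintype κ] {R : V → κ → V → κ → Prop} {G : SimpleGraph V}

theorem card_filter_isFlaw_le [Nonempty κ] (hsymm : ∀ u i v j, R u i v j → R v j u i)
    (hmatch : ∀ u i v j j', R u i v j → R u i v j' → j = j')
    (hadj : ∀ u i v j, R u i v j → G.Adj u v) (hG : G.CliqueFree 3) (h : V → Option κ) (v : V)
    {d : ℕ} (hd : #{u | G.Adj v u} ≤ d) (D : ℕ) :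
    (#{f ∈ Fintype.piFinset (recolorings R G h v) | IsFlaw R D v f} : ℝ) ≤
      (2 ^ (4 * D) * exp (-(Fintype.card κ / 2 * exp (-(2 * d / Fintype.card κ)))) +
        Fintype.card κ / 2 ^ D) * #(Fintype.piFinset (recolorings R G h v)) := by
  set P := Fintype.piFinset (recolorings R G h v)
  have h1 : #{f ∈ P | IsFlaw R D v f} ≤ #{f ∈ P | #(availableColors R f v) < 4 * D} +
      ∑ c, #{f ∈ P | c ∈ availableColors R f v ∧ D < #(blankConflicts R f v c)} := by
    refine (Finset.card_le_card (t := {f ∈ P | #(availableColors R f v) < 4 * D} ∪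
      univ.biUnion fun c =>
        {f ∈ P | c ∈ availableColors R f v ∧ D < #(blankConflicts R f v c)}) ?_).trans
      ((Finset.card_union_le _ _).trans (Nat.add_le_add_left Finset.card_biUnion_le _))
    intro f hf
    obtain ⟨hf, -, hlt | ⟨c, hc⟩⟩ := mem_filter.1 hf
    · exact Finset.mem_union_left _ (mem_filter.2 ⟨hf, hlt⟩)
    · exact Finset.mem_union_right _ (mem_biUnion.2 ⟨c, mem_univ _, mem_filter.2 ⟨hf, hc⟩⟩)
  have h2 := card_filter_card_availableColors_lt_le hsymm hmatch hadj h v hd (4 * D)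
  have h3 : ∀ c, (#{f ∈ P | c ∈ availableColors R f v ∧ D < #(blankConflicts R f v c)} : ℝ) ≤
      #P / 2 ^ D := by
    intro c
    rw [le_div_iff₀ (by positivity)]
    exact_mod_cast card_filter_lt_blankConflicts_mul_le hmatch hadj hG h v c D
  have h4 := Finset.sum_le_card_nsmul univ _ _ fun c _ => h3 c
  have h5 : (#{f ∈ P | IsFlaw R D v f} : ℝ) ≤ #{f ∈ P | #(availableColors R f v) < 4 * D} +
      ∑ c, (#{f ∈ P | c ∈ availableColors R f v ∧ D < #(blankConflicts R f v c)} : ℝ) := by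
    exact_mod_cast h1
  rw [nsmul_eq_mul, Finset.card_univ] at h4
  calc _ ≤ _ := h5.trans (add_le_add h2 h4)
    _ = _ := by ring

theorem card_filter_isFlaw_and_le [Nonempty κ] (hsymm : ∀ u i v j, R u i v j → R v j u i)
    (hmatch : ∀ u i v j j', R u i v j → R u i v j' → j = j')
    (hadj : ∀ u i v j, R u i v j → G.Adj u v) (hG : G.CliqueFree 3) (v : V)
    {d : ℕ} (hd : #{u | G.Adj v u} ≤ d) (D : ℕ) {T : Finset V}
    (hT : ∀ w ∈ T, w ≠ v ∧ ¬ G.Adj v w ∧ (∀ x, G.Adj w x → ¬ G.Adj v x) ∧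
      ∀ y x, G.Adj w y → G.Adj y x → ¬ G.Adj v x) :
    (#{f ∈ partialColorings R | IsFlaw R D v f ∧ ∀ w ∈ T, ¬ IsFlaw R D w f} : ℝ) ≤
      (2 ^ (4 * D) * exp (-(Fintype.card κ / 2 * exp (-(2 * d / Fintype.card κ)))) +
        Fintype.card κ / 2 ^ D) *
          #{f ∈ partialColorings R | ∀ w ∈ T, ¬ IsFlaw R D w f} := by
  set X : Finset (V → Option κ) :=
    {f ∈ partialColorings R | f v = none ∧ ∀ w ∈ T, ¬ IsFlaw R D w f} with hX
  set res : (V → Option κ) → V → Option κ := fun f u => if G.Adj v u then none else f u with hres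
  have hresv : ∀ f u, G.Adj v u → res f u = none := fun f u hu => by simp [hres, hu]
  have hresn : ∀ f u, ¬ G.Adj v u → res f u = f u := fun f u hu => by simp [hres, hu]
  have hfiber : ∀ h ∈ X.image res, ({f ∈ X | res f = h} : Finset (V → Option κ)) =
      Fintype.piFinset (recolorings R G h v) := by
    intro h hh
    obtain ⟨f₀, hf₀, rfl⟩ := mem_image.1 hh
    obtain ⟨hf₀, hf₀v, hf₀T⟩ := mem_filter.1 hf₀
    have hpart : res f₀ ∈ partialColorings R := by
      simp only [partialColorings, mem_filter, mem_univ, true_and] at hf₀ ⊢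
      have key : ∀ u i, res f₀ u = some i → f₀ u = some i := by
        intro u i hi
        by_cases hu : G.Adj v u
        · rw [hresv _ _ hu] at hi
          cases hi
        · rwa [hresn _ _ hu] at hi
      exact fun u w i j hi hj => hf₀ u w i j (key _ _ hi) (key _ _ hj)
    ext f
    rw [mem_piFinset_recolorings hsymm hadj hG hpart (hresv f₀), mem_filter, hX, mem_filter]
    constructor
    · rintro ⟨⟨hf, -, -⟩, hff₀⟩
      exact ⟨hf, fun u hu => by rw [← hff₀, hresn _ _ hu]⟩
    · rintro ⟨hf, hff₀⟩
      have hagree : ∀ u, ¬ G.Adj v u → f u = f₀ u := fun u hu => (hff₀ u hu).trans (hresn _ _ hu)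
      refine ⟨⟨hf, (hagree v (G.loopless.irrefl v)).trans hf₀v, fun w hw hflaw => ?_⟩, ?_⟩
      · obtain ⟨-, h₀, h₁, h₂⟩ := hT w hw
        exact hf₀T w hw (hflaw.congr hadj (hagree w h₀) (fun x hx => hagree x (h₁ x hx))
          fun y x hy hx => hagree x (h₂ y x hy hx))
      · ext1 u
        by_cases hu : G.Adj v u
        · rw [hresv _ _ hu, hresv _ _ hu]
        · rw [hresn _ _ hu, hff₀ u hu]
  have hbad : ({f ∈ partialColorings R | IsFlaw R D v f ∧ ∀ w ∈ T, ¬ IsFlaw R D w f} :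
      Finset (V → Option κ)) = {f ∈ X | IsFlaw R D v f} := by
    ext f
    simp only [hX, mem_filter]
    constructor
    · rintro ⟨hf, hv, h⟩
      exact ⟨⟨hf, hv.1, h⟩, hv⟩
    · rintro ⟨⟨hf, -, h⟩, hv⟩
      exact ⟨hf, hv, h⟩
  have hXle : #X ≤ #{f ∈ partialColorings R | ∀ w ∈ T, ¬ IsFlaw R D w f} := by
    apply Finset.card_le_card
    exact fun f hf => mem_filter.2 ⟨(mem_filter.1 hf).1, (mem_filter.1 hf).2.2⟩
  rw [hbad]
  refine le_trans ?_ (mul_le_mul_of_nonneg_left (Nat.cast_le.2 hXle) (by positivity))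
  rw [Finset.card_eq_sum_card_fiberwise (f := res) (t := X.image res) (s := X)
    (fun f hf => Finset.mem_coe.2 (mem_image_of_mem _ hf)),
    Finset.card_eq_sum_card_fiberwise (f := res) (t := X.image res)
    (fun f hf => Finset.mem_coe.2 (mem_image_of_mem _ (Finset.mem_of_mem_filter _ hf)))]
  push_cast
  rw [Finset.mul_sum]
  refine Finset.sum_le_sum fun h hh => ?_
  rw [Finset.filter_comm, hfiber h hh]
  exact card_filter_isFlaw_le hsymm hmatch hadj hG h v hd D

/-- A triangle-free conflict relation of bounded degree has a coloring, provided that the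
failure probability of a vertex is small. -/
theorem exists_coloring_of_cliqueFree [Nonempty κ] (hsymm : ∀ u i v j, R u i v j → R v j u i)
    (hmatch : ∀ u i v j j', R u i v j → R u i v j' → j = j')
    (hadj : ∀ u i v j, R u i v j → G.Adj u v) (hG : G.CliqueFree 3) {d : ℕ}
    (hd : ∀ v, #{u | G.Adj v u} ≤ d) {D : ℕ} (hD : 0 < D)
    (hp : 4 * (d + 1) ^ 3 *
      (2 ^ (4 * D) * exp (-(Fintype.card κ / 2 * exp (-(2 * d / Fintype.card κ)))) +
        Fintype.card κ / 2 ^ D) ≤ 1) :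
    ∃ g : V → κ, ∀ u v, ¬ R u (g u) v (g v) := by
  set nbhd : Finset V → Finset V := fun S => S.biUnion fun u =>
    insert u ({w | G.Adj u w} : Finset V) with hnbhd
  have hcard : ∀ S, #(nbhd S) ≤ #S * (d + 1) := fun S =>
    Finset.card_biUnion_le_card_mul _ _ _ fun u _ =>
      (Finset.card_insert_le _ _).trans (Nat.add_le_add_right (hd u) 1)
  have hself : ∀ S u, u ∈ S → u ∈ nbhd S := fun S u hu =>
    mem_biUnion.2 ⟨u, hu, Finset.mem_insert_self _ _⟩
  have hstep : ∀ S u w, u ∈ S → G.Adj u w → w ∈ nbhd S := fun S u w hu h =>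
    mem_biUnion.2 ⟨u, hu, Finset.mem_insert_of_mem (mem_filter.2 ⟨mem_univ _, h⟩)⟩
  obtain ⟨f, hf, hflaw⟩ := exists_forall_not_of_card_mul_le (X := partialColorings R)
    ⟨fun _ => none, by simp [partialColorings]⟩ (IsFlaw R D)
    (fun v => nbhd (nbhd (nbhd {v}))) (m := (d + 1) ^ 3) (by positivity)
    (fun v => by
      calc _ ≤ #({v} : Finset V) * (d + 1) * (d + 1) * (d + 1) :=
            (hcard _).trans (Nat.mul_le_mul_right _ ((hcard _).trans
              (Nat.mul_le_mul_right _ (hcard _))))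
        _ = (d + 1) ^ 3 := by rw [Finset.card_singleton]; ring)
    (fun v T hT => by
      have hv : v ∈ ({v} : Finset V) := mem_singleton_self v
      have hbound := card_filter_isFlaw_and_le hsymm hmatch hadj hG v (hd v) D (T := T)
        fun w hw => by
          have hw' := Finset.disjoint_left.1 hT hw
          refine ⟨?_, fun h => ?_, fun x h h' => ?_, fun y x h₁ h₂ h' => ?_⟩
          · rintro rfl
            exact hw' (hself _ _ (hself _ _ (hself _ _ hv)))
          · exact hw' (hself _ _ (hself _ _ (hstep _ _ _ hv h)))
          · exact hw' (hself _ _ (hstep _ _ _ (hstep _ _ _ hv h') h.symm))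
          · exact hw' (hstep _ _ _ (hstep _ _ _ (hstep _ _ _ hv h') h₂.symm) h₁.symm)
      have h1 := mul_le_mul_of_nonneg_left hbound
        (by positivity : (0 : ℝ) ≤ 4 * (d + 1) ^ 3)
      rw [← mul_assoc] at h1
      have h2 := h1.trans (mul_le_mul_of_nonneg_right hp (Nat.cast_nonneg _))
      rw [one_mul] at h2
      convert (by exact_mod_cast h2 : 4 * (d + 1) ^ 3 *
        #{f ∈ partialColorings R | IsFlaw R D v f ∧ ∀ w ∈ T, ¬ IsFlaw R D w f} ≤
          #{f ∈ partialColorings R | ∀ w ∈ T, ¬ IsFlaw R D w f})) univ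
  have hfU : ∀ v ∈ ({v | f v = none} : Finset V), 4 * D ≤ #(availableColors R f v) ∧
      ∀ c ∈ availableColors R f v, #(blankConflicts R f v c) ≤ D := by
    intro v hv
    have := hflaw v (mem_univ v)
    simpa [IsFlaw, (mem_filter.1 hv).2] using this
  obtain ⟨g, hg⟩ := exists_listColoring hsymm
    (fun v i j h => G.loopless.irrefl v (hadj _ _ _ _ h)) hmatch hD (availableColors R f)
    {v | f v = none} (fun v hv => (hfU v hv).1) (fun v hv c hc => by
      rw [Finset.filter_filter]
      exact (hfU v hv).2 c hc)
  simp only [listColorings, mem_filter, mem_univ, true_and] at hg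
  obtain ⟨-, hgmem, hgR⟩ := hg
  have hdich : ∀ v, ∃ c, f v = some c ∨ f v = none ∧ c ∈ availableColors R f v ∧ g v = some c := by
    intro v
    rcases hfv : f v with _ | c
    · obtain ⟨c, hc⟩ := hgmem v hfv
      exact ⟨c, Or.inr ⟨rfl, hc⟩⟩
    · exact ⟨c, Or.inl rfl⟩
  choose φ hφ using hdich
  simp only [partialColorings, availableColors, mem_filter, mem_univ, true_and] at hf hφ
  refine ⟨φ, fun u v hR => ?_⟩
  rcases hφ u with hu | ⟨-, hu, hgu⟩ <;> rcases hφ v with hv | ⟨-, hv, hgv⟩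
  · exact hf u v _ _ hu hv hR
  · exact hv u _ hu (hsymm _ _ _ _ hR)
  · exact hu v _ hv hR
  · exact hgR u v _ _ hgu hgv hR

end Relation

theorem exp_neg_one_le_half : exp (-1) ≤ 1 / 2 := by
  rw [Real.exp_neg, ← one_div]
  apply one_div_le_one_div_of_le two_pos
  linarith [exp_one_gt_d9]

theorem two_pow_eq_exp (n : ℕ) : (2 : ℝ) ^ n = exp (log 2 * n) := by
  rw [← Real.rpow_natCast, Real.rpow_def_of_pos two_pos]

theorem four_mul_add_one_pow_three_le {x : ℝ} (hx : 1 ≤ x) :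
    4 * (x + 1) ^ 3 ≤ exp (5 + 3 * log x) := by
  have hx0 : 0 < x := by linarith
  have h5 : (2 : ℝ) ^ 5 ≤ exp 5 := by
    rw [two_pow_eq_exp]
    apply exp_le_exp.2
    push_cast
    linarith [log_two_lt_d9]
  have h3 : exp (3 * log x) = x ^ 3 := by
    rw [mul_comm, Real.exp_mul, exp_log hx0]
    norm_cast
  have h6 : (x + 1) ^ 3 ≤ (2 * x) ^ 3 := by gcongr; linarith
  rw [Real.exp_add, h3]
  nlinarith [pow_pos hx0 3]

/-- The probability that some available color has too many conflicts is small. -/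
theorem mul_div_two_pow_le_half {x y k : ℝ} {D : ℕ} (hx : 1 ≤ x) (hy : 4 ≤ y) (hlog : log x ≤ y)
    (hk0 : 0 ≤ k) (hk : k ≤ 9 * x) (hD : y ^ 4 ≤ D) : 4 * (x + 1) ^ 3 * (k / 2 ^ D) ≤ 1 / 2 := by
  have hx0 : 0 < x := by linarith
  have hy0 : 0 < y := by linarith
  have h9 : k ≤ exp (4 + log x) := by
    have : (2 : ℝ) ^ 4 ≤ exp 4 := by
      rw [two_pow_eq_exp]
      apply exp_le_exp.2
      push_cast
      linarith [log_two_lt_d9]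
    rw [Real.exp_add, exp_log hx0]
    nlinarith
  have h2D : ((2 : ℝ) ^ D)⁻¹ ≤ exp (-(log 2 * y ^ 4)) := by
    rw [Real.exp_neg, two_pow_eq_exp]
    apply inv_anti₀ (exp_pos _)
    apply exp_le_exp.2
    gcongr
  have hy4 : 64 * y ≤ y ^ 4 := by nlinarith [pow_le_pow_left₀ (by norm_num) hy 3]
  calc _ ≤ exp (5 + 3 * log x) * (exp (4 + log x) * exp (-(log 2 * y ^ 4))) := by
        rw [div_eq_mul_inv]
        have := four_mul_add_one_pow_three_le hx
        gcongr
    _ = exp (9 + 4 * log x - log 2 * y ^ 4) := by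
        rw [← Real.exp_add, ← Real.exp_add]; congr 1; ring
    _ ≤ exp (-1) := by
        apply exp_le_exp.2
        nlinarith [mul_le_mul_of_nonneg_right log_two_gt_d9.le (pow_pos hy0 4).le]
    _ ≤ _ := exp_neg_one_le_half

/-- The probability that too few colors are available is small. -/
theorem mul_two_pow_mul_exp_le_half {x y k : ℝ} {D : ℕ} (hx : 3 ≤ x) (hy : 4 ≤ y)
    (hxy : y = x ^ (1 / 8 : ℝ)) (hlog : log x ≤ y) (hk : 8 * x / log x ≤ k)
    (hD : (D : ℝ) ≤ y ^ 4 + 1) :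
    4 * (x + 1) ^ 3 * (2 ^ (4 * D) * exp (-(k / 2 * exp (-(2 * x / k))))) ≤ 1 / 2 := by
  have hx0 : 0 < x := by linarith
  have hy0 : 0 < y := by linarith
  have hL : 0 < log x := Real.log_pos (by linarith)
  have hkpos : 0 < k := lt_of_lt_of_le (by positivity) hk
  have hx8 : x = y ^ 8 := by
    rw [hxy, ← rpow_natCast, ← rpow_mul hx0.le]
    norm_num
  have hinner : 4 * y ^ 5 ≤ k / 2 * exp (-(2 * x / k)) := by
    have h4 : 2 * x / k ≤ log x / 4 := by
      rw [div_le_iff₀ hkpos]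
      rw [div_le_iff₀ hL] at hk
      linarith
    have h5 : exp (log x / 4) = y ^ 2 := by
      rw [hxy, ← rpow_natCast, ← rpow_mul hx0.le, Real.rpow_def_of_pos hx0]
      congr 1
      push_cast
      ring
    have h6 : (y ^ 2)⁻¹ ≤ exp (-(2 * x / k)) := by
      rw [← h5, ← Real.exp_neg]
      exact exp_le_exp.2 (by linarith)
    have h7 : 8 * y ^ 7 ≤ k := by
      refine le_trans ?_ hk
      rw [le_div_iff₀ hL]
      calc 8 * y ^ 7 * log x ≤ 8 * y ^ 7 * y := by gcongr
        _ = 8 * x := by rw [hx8]; ring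
    calc 4 * y ^ 5 = 8 * y ^ 7 / 2 * (y ^ 2)⁻¹ := by field_simp; norm_num
      _ ≤ _ := by gcongr
  have h2D : (2 : ℝ) ^ (4 * D) ≤ exp (4 * (y ^ 4 + 1)) := by
    rw [two_pow_eq_exp]
    apply exp_le_exp.2
    push_cast
    nlinarith [log_two_lt_d9, Nat.cast_nonneg (α := ℝ) D]
  have hy4 : 64 * y ≤ y ^ 4 := by nlinarith [pow_le_pow_left₀ (by norm_num) hy 3]
  have hy5 : 4 * y ^ 4 ≤ y ^ 5 := by nlinarith [pow_pos hy0 4]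
  calc _ ≤ exp (5 + 3 * log x) * (exp (4 * (y ^ 4 + 1)) * exp (-(4 * y ^ 5))) := by
        have := four_mul_add_one_pow_three_le (by linarith : 1 ≤ x)
        gcongr
    _ = exp (9 + 3 * log x + 4 * y ^ 4 - 4 * y ^ 5) := by
        rw [← Real.exp_add, ← Real.exp_add]; congr 1; ring
    _ ≤ exp (-1) := by
        apply exp_le_exp.2
        linarith
    _ ≤ _ := exp_neg_one_le_half

/-- With `⌈8 d / log d⌉` colors, the failure probability of a vertex is eventually small enough
for the local lemma. -/
theorem eventually_failure_le : ∀ᶠ d : ℕ in Filter.atTop, ∃ D : ℕ, 0 < D ∧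
    4 * ((d : ℝ) + 1) ^ 3 *
      (2 ^ (4 * D) * exp (-((⌈8 * (d : ℝ) / log d⌉₊ : ℝ) / 2 *
        exp (-(2 * d / (⌈8 * (d : ℝ) / log d⌉₊ : ℝ))))) +
        (⌈8 * (d : ℝ) / log d⌉₊ : ℝ) / 2 ^ D) ≤ 1 := by
  have hlog := (isLittleO_log_rpow_atTop (r := 1 / 8) (by norm_num)).bound one_pos
  have hbig := (tendsto_rpow_atTop (y := 1 / 8) (by norm_num)).eventually_ge_atTop 4
  filter_upwards [tendsto_natCast_atTop_atTop.eventually hlog,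
    tendsto_natCast_atTop_atTop.eventually hbig, Filter.eventually_ge_atTop 3] with d h1 h2 h3
  have hx3 : (3 : ℝ) ≤ d := by exact_mod_cast h3
  have hL1 : 1 ≤ log (d : ℝ) := by
    rw [le_log_iff_exp_le (by linarith)]
    linarith [exp_one_lt_d9]
  have hLy : log (d : ℝ) ≤ (d : ℝ) ^ (1 / 8 : ℝ) := by
    rw [one_mul, norm_of_nonneg (by linarith : 0 ≤ log (d : ℝ)), norm_of_nonneg (by positivity)]
      at h1
    exact h1
  have hk : (⌈8 * (d : ℝ) / log d⌉₊ : ℝ) ≤ 9 * d := by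
    have h4 := Nat.ceil_lt_add_one (by positivity : 0 ≤ 8 * (d : ℝ) / log d)
    have h5 : 8 * (d : ℝ) / log d ≤ 8 * d := div_le_self (by positivity) hL1
    linarith
  refine ⟨⌈((d : ℝ) ^ (1 / 8 : ℝ)) ^ 4⌉₊, Nat.ceil_pos.2 (by positivity), ?_⟩
  rw [mul_add]
  have h6 := mul_div_two_pow_le_half (by linarith) h2 hLy (Nat.cast_nonneg _) hk (Nat.le_ceil _)
  have h7 := mul_two_pow_mul_exp_le_half hx3 h2 rfl hLy (Nat.le_ceil _)
    (Nat.ceil_lt_add_one (by positivity)).le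
  linarith

section CorrColorable

variable {V : Type} [Fintype V] {G : SimpleGraph V}

theorem CorrColorable.mono {k l : ℕ} (hkl : k ≤ l) (h : CorrColorable G k) : CorrColorable G l :=
  fun W _ C hC => h W C fun v => hkl.trans (hC v)

theorem corrColorable_of_forall_relation {k : ℕ}
    (h : ∀ R : V → Fin k → V → Fin k → Prop, (∀ u i v j, R u i v j → R v j u i) →
      (∀ u i v j j', R u i v j → R u i v j' → j = j') → (∀ u i v j, R u i v j → G.Adj u v) →
      ∃ g : V → Fin k, ∀ u v, ¬ R u (g u) v (g v)) : CorrColorable G k := by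
  intro W _ C hC
  have e : ∀ v, Fin k ↪ {x : W // C.toFun x = v} := fun v =>
    (Function.Embedding.nonempty_of_card_le (by simpa using hC v)).some
  obtain ⟨g, hg⟩ := h (fun u i v j => C.graph.Adj (e u i) (e v j)) (fun u i v j h => h.symm)
    (fun u i v j j' h h' => (e v).injective (Subtype.ext
      (C.matching h h' ((e v j).2.trans (e v j').2.symm))))
    (fun u i v j h => by simpa [(e u i).2, (e v j).2] using C.adj_map h)
  refine ⟨Set.range fun v => (e v (g v) : W), ?_, fun v => ⟨_, ⟨v, rfl⟩, (e v (g v)).2⟩⟩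
  rintro _ ⟨u, rfl⟩ _ ⟨v, rfl⟩
  exact hg u v

theorem corrColorable_four_mul {d : ℕ} (hd0 : 0 < d) (hd : ∀ v, #{u | G.Adj v u} ≤ d) :
    CorrColorable G (4 * d) := by
  refine corrColorable_of_forall_relation fun R hsymm hmatch hadj => ?_
  obtain ⟨g, hg⟩ := exists_listColoring hsymm
    (fun v i j h => G.loopless.irrefl v (hadj _ _ _ _ h)) hmatch hd0 (fun _ => univ) univ
    (by simp) fun v _ c _ => (Finset.card_le_card fun u hu => by
      simp only [mem_filter, mem_univ, true_and] at hu ⊢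
      obtain ⟨j, hR⟩ := hu
      exact hadj _ _ _ _ hR).trans (hd v)
  simp only [listColorings, mem_filter, mem_univ, true_and] at hg
  choose φ hφ using fun v => hg.2.1 v trivial
  exact ⟨φ, fun u v => hg.2.2 u v _ _ (hφ u) (hφ v)⟩

theorem eventually_corrColorable_ceil : ∀ᶠ d : ℕ in Filter.atTop,
    ∀ (V : Type) [Fintype V] (G : SimpleGraph V), G.CliqueFree 3 → (∀ v, #{u | G.Adj v u} ≤ d) →
      CorrColorable G ⌈8 * (d : ℝ) / log d⌉₊ := by
  filter_upwards [eventually_failure_le, Filter.eventually_ge_atTop 2] with d ⟨D, hD, hp⟩ hd2 V _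
    G hG hd
  refine corrColorable_of_forall_relation fun R hsymm hmatch hadj => ?_
  have hlog : 0 < log (d : ℝ) := Real.log_pos (by exact_mod_cast hd2)
  have hpos : 0 < ⌈8 * (d : ℝ) / log d⌉₊ := Nat.ceil_pos.2 (by positivity)
  have : Nonempty (Fin ⌈8 * (d : ℝ) / log d⌉₊) := ⟨⟨0, hpos⟩⟩
  exact exists_coloring_of_cliqueFree hsymm hmatch hadj hG hd hD (by simpa using hp)

theorem not_corrColorable_zero [Nonempty V] : ¬ CorrColorable G 0 := by
  intro h
  obtain ⟨I, -, hI⟩ := h Empty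
    ⟨Empty.elim, ⊥, fun x => x.elim, fun x => x.elim⟩ fun _ => Nat.zero_le _
  obtain ⟨x, -⟩ := hI (Classical.arbitrary V)
  exact x.elim

/-- The sum of the values of `f` at the ends of an edge. -/
def edgeSum {k : ℕ} (f : V → ZMod k) : Sym2 V → ZMod k :=
  Sym2.lift ⟨fun u v => f u + f v, fun _ _ => add_comm _ _⟩

/-- The cover in which the colors `i` of `u` and `j` of `v` conflict iff `i + j` is the label of
the edge `uv`. -/
def sumCover {k : ℕ} (s : G.edgeSet → ZMod k) : Cover G (V × ZMod k) where
  toFun := Prod.fst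
  graph :=
    { Adj := fun x y => ∃ h : s(x.1, y.1) ∈ G.edgeSet, x.2 + y.2 = s ⟨s(x.1, y.1), h⟩
      symm := ⟨fun x y ⟨h, hs⟩ => by
        have hswap : s(y.1, x.1) = s(x.1, y.1) := Sym2.eq_swap
        exact ⟨hswap ▸ h, by rw [add_comm, hs]; congr 2; exact hswap.symm⟩⟩
      loopless := ⟨fun x ⟨h, _⟩ => G.loopless.irrefl x.1 h⟩ }
  adj_map := fun _ _ ⟨h, _⟩ => h
  matching := by
    rintro ⟨u, i⟩ ⟨v, j⟩ ⟨w, l⟩ ⟨h, hs⟩ ⟨h', hs'⟩ rfl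
    exact Prod.ext rfl (add_left_cancel (hs.trans hs'.symm))

/-- First-moment bound: some cover by `k` colors has no coloring when `G` has many edges. -/
theorem not_corrColorable_of_pow_mul_lt {k : ℕ} [NeZero k]
    (h : k ^ Fintype.card V * (k - 1) ^ Fintype.card G.edgeSet < k ^ Fintype.card G.edgeSet) :
    ¬ CorrColorable G k := by
  intro hk
  have hcol : ∀ s : G.edgeSet → ZMod k, ∃ f : V → ZMod k, ∀ e, s e ≠ edgeSum f e := by
    intro s
    obtain ⟨I, hind, hI⟩ := hk (V × ZMod k) (sumCover s) fun v => by
      have : Fintype.card {x : V × ZMod k // x.1 = v} = k := by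
        rw [Fintype.card_congr (Equiv.prodSubtypeFstEquivSubtypeProd (p := fun u => u = v))]
        simp [ZMod.card]
      exact this.ge
    choose x hx hxv using hI
    refine ⟨fun v => (x v).2, ?_⟩
    rintro ⟨e, he⟩
    induction e using Sym2.ind with
    | _ u v =>
      intro heq
      have hu : (x u).1 = u := hxv u
      have hv : (x v).1 = v := hxv v
      refine hind (hx u) (hx v) ⟨by rw [hu, hv]; exact he, ?_⟩
      exact heq.symm.trans (congrArg s (Subtype.ext (congrArg₂ (fun a b => s(a, b)) hu hv).symm))
  have hcover : (univ : Finset (G.edgeSet → ZMod k)) ⊆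
      univ.biUnion fun f : V → ZMod k =>
        Fintype.piFinset fun e : G.edgeSet => univ.erase (edgeSum f e) := by
    intro s _
    obtain ⟨f, hf⟩ := hcol s
    exact mem_biUnion.2 ⟨f, mem_univ _, Fintype.mem_piFinset.2 fun e =>
      Finset.mem_erase.2 ⟨hf e, mem_univ _⟩⟩
  have hle := (Finset.card_le_card hcover).trans Finset.card_biUnion_le
  simp only [Fintype.card_piFinset, Finset.card_erase_of_mem (mem_univ _), Finset.card_univ,
    ZMod.card, Finset.prod_const, Finset.sum_const, Fintype.card_fun, smul_eq_mul] at hle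
  exact absurd h hle.not_gt

theorem not_corrColorable_of_mul_log_lt [Nonempty V] [DecidableRel G.Adj] {d k : ℕ}
    (hG : G.IsRegularOfDegree d) (hk : 0 < k) (h : 2 * (k * log k) < d) :
    ¬ CorrColorable G k := by
  have : NeZero k := ⟨hk.ne'⟩
  apply not_corrColorable_of_pow_mul_lt
  have hedges : Fintype.card V * d = 2 * Fintype.card G.edgeSet := by
    have := G.sum_degrees_eq_twice_card_edges
    simp only [hG.degree_eq, Finset.sum_const, Finset.card_univ, smul_eq_mul] at this
    rw [this, ← SimpleGraph.edgeFinset_card]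
  set n := Fintype.card V with hn
  set m := Fintype.card G.edgeSet with hm
  have hn0 : (0 : ℝ) < n := by simp only [hn]; exact_mod_cast Fintype.card_pos
  have hk0 : (0 : ℝ) < k := by exact_mod_cast hk
  have hedges' : (n * d : ℝ) = 2 * m := by exact_mod_cast hedges
  have h1 : ((k - 1 : ℕ) : ℝ) ≤ k * exp (-(1 / k)) := by
    rw [Nat.cast_sub hk, Nat.cast_one]
    have := add_one_le_exp (-(1 / (k : ℝ)))
    calc (k : ℝ) - 1 = k * (-(1 / k) + 1) := by field_simp; ring
      _ ≤ _ := by gcongr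
  have h2 : (k : ℝ) ^ n = exp (n * log k) := by
    rw [← Real.rpow_natCast, Real.rpow_def_of_pos hk0, mul_comm]
  have h3 : (k : ℝ) ^ n * ((k - 1 : ℕ) : ℝ) ^ m < k ^ m := by
    calc (k : ℝ) ^ n * ((k - 1 : ℕ) : ℝ) ^ m ≤ exp (n * log k) * (k * exp (-(1 / k))) ^ m := by
          rw [h2]
          gcongr
      _ = exp (n * log k - m / k) * k ^ m := by
          rw [mul_pow, ← Real.exp_nat_mul, mul_left_comm, ← Real.exp_add, mul_comm]
          congr 2
          ring
      _ < 1 * k ^ m := by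
          gcongr
          rw [Real.exp_lt_one_iff, sub_neg, lt_div_iff₀ hk0]
          nlinarith [mul_lt_mul_of_pos_left h hn0]
      _ = k ^ m := one_mul _
  have h4 : k ^ n * (k - 1) ^ m < k ^ m := by exact_mod_cast h3
  convert h4

end CorrColorable

/-- **Corollary.** There are constants `c, C > 0` such that for every `d ≥ 6` and every
finite simple `d`-regular triangle-free graph `G`,
`c·d/ln d ≤ χ_c(G) ≤ C·d/ln d`. -/
theorem corrChromaticNumber_regular_triangleFree :
    ∃ c C : ℝ, 0 < c ∧ 0 < C ∧
      ∀ d : ℕ, 6 ≤ d →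
        ∀ (V : Type) [Fintype V] [Nonempty V] (G : SimpleGraph V) [DecidableRel G.Adj],
          G.CliqueFree 3 → G.IsRegularOfDegree d →
          c * d / Real.log d ≤ (corrChromaticNumber G : ℝ) ∧
            (corrChromaticNumber G : ℝ) ≤ C * d / Real.log d := by
  obtain ⟨d₀, hd₀⟩ := Filter.eventually_atTop.1 eventually_corrColorable_ceil
  have hlog₀ : 0 ≤ log ((d₀ : ℝ) + 1) := Real.log_nonneg (by linarith [d₀.cast_nonneg (α := ℝ)])
  refine ⟨1 / 2, 9 + 4 * log (d₀ + 1), by norm_num, by positivity, ?_⟩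
  intro d hd6 V _ _ G inst hG hreg
  obtain rfl : inst = fun _ _ => propDecidable _ := Subsingleton.elim _ _
  have hd0 : 0 < d := by omega
  have hd : (6 : ℝ) ≤ d := by exact_mod_cast hd6
  have hdeg : ∀ v, #{u | G.Adj v u} ≤ d := by
    intro v
    rw [← hreg.degree_eq v, ← G.card_neighborFinset_eq_degree, G.neighborFinset_eq_filter]
  have hlog1 : 1 ≤ log (d : ℝ) := by
    rw [le_log_iff_exp_le (by linarith)]
    linarith [exp_one_lt_d9]
  have hmem : CorrColorable G (corrChromaticNumber G) :=
    Nat.sInf_mem (s := {k | CorrColorable G k}) ⟨_, corrColorable_four_mul hd0 hdeg⟩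
  constructor
  · have hnot : ¬ CorrColorable G ⌊(d : ℝ) / (2 * log d)⌋₊ := by
      rcases Nat.eq_zero_or_pos ⌊(d : ℝ) / (2 * log d)⌋₊ with h0 | hpos
      · rw [h0]
        exact not_corrColorable_zero
      · refine not_corrColorable_of_mul_log_lt hreg hpos ?_
        set k := ⌊(d : ℝ) / (2 * log d)⌋₊
        have hk0 : (0 : ℝ) < k := by exact_mod_cast hpos
        have hkle : (k : ℝ) ≤ d / (2 * log d) := Nat.floor_le (by positivity)
        rw [le_div_iff₀ (by positivity)] at hkle
        have hlt : log (k : ℝ) < log d := Real.log_lt_log hk0 (by nlinarith)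
        nlinarith
    have hlt : ⌊(d : ℝ) / (2 * log d)⌋₊ < corrChromaticNumber G :=
      lt_of_not_ge fun hle => hnot (hmem.mono hle)
    calc 1 / 2 * d / log d = d / (2 * log d) := by field_simp
      _ ≤ _ := ((Nat.floor_lt (by positivity)).1 hlt).le
  · rw [mul_div_assoc]
    have hdl : 0 ≤ (d : ℝ) / log d := by positivity
    rcases le_total d₀ d with hle | hle
    · have h1 : corrChromaticNumber G ≤ ⌈8 * (d : ℝ) / log d⌉₊ :=
        Nat.sInf_le (hd₀ d hle V G hG hdeg)
      have h2 : (corrChromaticNumber G : ℝ) ≤ 8 * d / log d + 1 :=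
        (Nat.cast_le.2 h1).trans (Nat.ceil_lt_add_one (by positivity)).le
      have h3 : 1 ≤ (d : ℝ) / log d := by
        rw [one_le_div (by linarith)]
        linarith [Real.log_le_sub_one_of_pos (by linarith : (0 : ℝ) < d)]
      rw [mul_div_assoc] at h2
      nlinarith [mul_nonneg hlog₀ hdl]
    · have h1 : corrChromaticNumber G ≤ 4 * d :=
        Nat.sInf_le (corrColorable_four_mul hd0 hdeg)
      have h2 : (corrChromaticNumber G : ℝ) ≤ 4 * d := by exact_mod_cast h1
      have h3 : log (d : ℝ) ≤ log (d₀ + 1) := by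
        apply Real.log_le_log (by linarith)
        have : (d : ℝ) ≤ d₀ := by exact_mod_cast hle
        linarith
      have h4 : log (d : ℝ) * (d / log d) = d := by field_simp
      nlinarith [mul_le_mul_of_nonneg_right h3 hdl]
end
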